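/- arXiv:1805.02086 — 2 statements merged into one kernel-verified Lean document; each statement's English description precedes it below -/
import Mathlib

section
/- Let n ≥ 2 and let U, V be nonempty open subsets of ℂⁿ. The set A of automorphisms f ∈ Aut_{ω₀}(ℂⁿ) that have a transverse cycle passing through both U and V is open and dense in Aut_{ω₀}(ℂⁿ). -/
open Topology Filter Metric Set Function

noncomputable section

/-- ℂⁿ with the Euclidean norm. -/
abbrev En (n : ℕ) : Type := EuclideanSpace ℂ (Fin n)

/-- A holomorphic automorphism of ℂⁿ: a bijection that is holomorphic with holomorphic inverse. -/
def IsHoloAut {n : ℕ} (f : En n → En n) : Prop :=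
  Differentiable ℂ f ∧ ∃ g : En n → En n, Differentiable ℂ g ∧
    Function.LeftInverse g f ∧ Function.RightInverse g f

/-- Volume-preserving with respect to ω₀ = dz₁∧⋯∧dzₙ: det Df(z) = 1 for all z. -/
def IsVolPres {n : ℕ} (f : En n → En n) : Prop :=
  ∀ z : En n, (fderiv ℂ f z).det = 1

/-- Aut(ℂⁿ) as a subset of C(ℂⁿ, ℂⁿ) with the compact-open topology. -/
def AutCN (n : ℕ) : Set C(En n, En n) := {f | IsHoloAut ⇑f}

/-- Aut_{ω₀}(ℂⁿ) as a subset of C(ℂⁿ, ℂⁿ) with the compact-open topology. -/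
def AutOmega (n : ℕ) : Set C(En n, En n) := {f | IsHoloAut ⇑f ∧ IsVolPres ⇑f}

/-- A continuous self-map is chaotic if it has a dense forward orbit and its set of
periodic points is dense. -/
def Chaotic {α : Type*} [TopologicalSpace α] (f : α → α) : Prop :=
  (∃ x : α, Dense (Set.range fun k : ℕ => f^[k] x)) ∧
  Dense {x : α | ∃ k : ℕ, 0 < k ∧ f^[k] x = x}

/-- Expelling: the set of points with unbounded forward orbit is dense. -/
def Expelling {n : ℕ} (f : En n → En n) : Prop :=
  Dense {x : En n | ¬ Bornology.IsBounded (Set.range fun k : ℕ => f^[k] x)}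

/-- p is a hyperbolic fixed point of f: f(p) = p and no eigenvalue of Df(p) has modulus 1. -/
def HypFixedPt {n : ℕ} (f : En n → En n) (p : En n) : Prop :=
  f p = p ∧ ∀ μ : ℂ, Module.End.HasEigenvalue
    ((fderiv ℂ f p : En n →ₗ[ℂ] En n) : Module.End ℂ (En n)) μ → ‖μ‖ ≠ 1

/-- The stable manifold of a fixed point p of f: points whose forward orbit tends to p. -/
def StableSet {n : ℕ} (f : En n → En n) (p : En n) : Set (En n) :=
  {x : En n | Tendsto (fun k : ℕ => f^[k] x) atTop (𝓝 p)}

/-- f has a transverse cycle passing through U and V: a cycle of some length k ≥ 1 (k distinct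
points cyclically permuted by f) such that D(f^k) at a point of the cycle does not have 1 as an
eigenvalue, with some point of the cycle in U and some point in V. -/
def HasTransverseCycleThrough {n : ℕ} (f : En n → En n) (U V : Set (En n)) : Prop :=
  ∃ (p : En n) (k : ℕ), 0 < k ∧ f^[k] p = p ∧
    Set.InjOn (fun i : ℕ => f^[i] p) (Set.Iio k) ∧
    ¬ Module.End.HasEigenvalue
      ((fderiv ℂ (f^[k]) p : En n →ₗ[ℂ] En n) : Module.End ℂ (En n)) 1 ∧
    (∃ i < k, f^[i] p ∈ U) ∧ (∃ i < k, f^[i] p ∈ V)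


section CX
variable {E F : Type*} [NormedAddCommGroup E] [NormedSpace ℂ E] [NormedAddCommGroup F] [NormedSpace ℂ F]

lemma cx_cauchy {f : E → F} (hf : Differentiable ℂ f) {c : E} {r M : ℝ} (hr : 0 < r)
    (hM : ∀ z ∈ ball c r, ‖f z‖ ≤ M) : ‖fderiv ℂ f c‖ ≤ 2 * M / r := by
  refine Complex.norm_fderiv_le_div_of_mapsTo_ball hf.differentiableOn (fun z hz => ?_) hr
  rw [mem_closedBall, dist_eq_norm]
  have h1 := hM z hz
  have h2 := hM c (mem_ball_self hr)
  linarith [norm_sub_le (f z) (f c)]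

lemma cx_taylor2 {f : E → F} (hf : Differentiable ℂ f) {c z : E} {r M : ℝ} (hr : 0 < r)
    (hM : ∀ z ∈ ball c r, ‖f z‖ ≤ M) (hz : z ∈ ball c r) :
    ‖f z - f c - fderiv ℂ f c (z - c)‖ ≤ 4 * M / r ^ 2 * ‖z - c‖ ^ 2 := by
  have hb := cx_cauchy hf hr hM
  have hM0 : 0 ≤ M := (norm_nonneg _).trans (hM c (mem_ball_self hr))
  set g : E → F := fun z => f z - fderiv ℂ f c (z - c) with hg
  have hgd : Differentiable ℂ g := by
    intro x
    have := hf x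
    fun_prop
  have hgc : g c = f c := by simp [hg]
  have key := Complex.dist_le_mul_div_pow_of_mapsTo_ball_of_isLittleO (f := g) (c := c) (z := z)
    (R₁ := r) (R₂ := 4 * M) (n := 1) hgd.differentiableOn ?_ ?_ hz
  · rw [dist_eq_norm, dist_eq_norm, hgc] at key
    have e : g z - f c = f z - f c - fderiv ℂ f c (z - c) := by simp [hg]; abel
    rw [e] at key
    refine key.trans (le_of_eq ?_)
    rw [div_pow]; ring
  · intro w hw
    rw [mem_closedBall, dist_eq_norm, hgc]
    have e : g w - f c = f w - f c - fderiv ℂ f c (w - c) := by simp [hg]; abel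
    rw [e]
    have h1 := hM w hw
    have h2 := hM c (mem_ball_self hr)
    have h3 : ‖fderiv ℂ f c (w - c)‖ ≤ 2 * M / r * r := by
      refine (ContinuousLinearMap.le_opNorm _ _).trans ?_
      rw [mem_ball, dist_eq_norm] at hw
      gcongr
    rw [div_mul_cancel₀ _ hr.ne'] at h3
    linarith [norm_sub_le (f w - f c) (fderiv ℂ f c (w - c)), norm_sub_le (f w) (f c)]
  · have h := (hf c).hasFDerivAt.isLittleO
    rw [hgc]
    have e : (fun x => g x - f c) = fun x => f x - f c - fderiv ℂ f c (x - c) := by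
      funext x; simp [hg]; abel
    rw [e]
    simpa using h.norm_right

lemma cx_lip {f : E → F} (hf : Differentiable ℂ f) {c x y : E} {r M : ℝ} (hr : 0 < r)
    (hM : ∀ z ∈ ball c (2 * r), ‖f z‖ ≤ M) (hx : x ∈ ball c r) (hy : y ∈ ball c r) :
    ‖f x - f y‖ ≤ 2 * M / r * ‖x - y‖ := by
  refine (convex_ball c r).norm_image_sub_le_of_norm_fderiv_le (𝕜 := ℂ) (fun z _ => hf z) (fun z hz => ?_) hy hx
  refine cx_cauchy hf hr fun w hw => hM w ?_
  simp only [mem_ball] at *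
  linarith [dist_triangle w z c]

lemma cx_lip_fderiv {f : E → F} (hf : Differentiable ℂ f) {c x y : E} {r M : ℝ} (hr : 0 < r)
    (hM : ∀ z ∈ ball c (4 * r), ‖f z‖ ≤ M) (hx : x ∈ ball c r) (hy : y ∈ ball c r) :
    ‖fderiv ℂ f x - fderiv ℂ f y‖ ≤ 2 * M / r ^ 2 * ‖x - y‖ := by
  have hd : Differentiable ℂ (fun z => f (z + (x - y)) - f z) := by
    have : Differentiable ℂ (fun z => f (z + (x - y))) := hf.comp (by fun_prop)
    exact this.sub hf
  have h1 : fderiv ℂ (fun z => f (z + (x - y)) - f z) y = fderiv ℂ f x - fderiv ℂ f y := by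
    rw [fderiv_fun_sub (by exact (hf.comp (by fun_prop : Differentiable ℂ (fun z : E => z + (x - y)))) y) (hf y)]
    congr 1
    rw [fderiv_comp_add_right]
    congr 1; abel
  rw [← h1]
  have h2 := cx_cauchy hd (c := y) hr (M := 2 * M / (2*r) * ‖x - y‖) ?_
  · refine h2.trans (le_of_eq ?_)
    field_simp
  · intro z hz
    have := cx_lip hf (c := c) (x := z + (x - y)) (y := z) (r := 2*r) (M := M) (by linarith)
      (fun w hw => hM w (by convert hw using 2; ring)) ?_ ?_
    · simpa using this
    · simp only [mem_ball, dist_eq_norm] at *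
      calc ‖z + (x - y) - c‖ = ‖(z - y) + (x - c)‖ := by congr 1; abel
        _ ≤ _ := norm_add_le _ _
        _ < 2 * r := by linarith
    · simp only [mem_ball] at *
      linarith [dist_triangle z y c]

lemma cx_cont_fderiv {f : E → F} (hf : Differentiable ℂ f) : Continuous (fderiv ℂ f) := by
  rw [continuous_iff_continuousAt]
  intro c
  obtain ⟨R, hR, hb⟩ : ∃ R > 0, ∀ z ∈ ball c R, ‖f z‖ ≤ ‖f c‖ + 1 := by
    have := (hf.continuous.norm.continuousAt (x := c)).eventually (gt_mem_nhds (lt_add_one ‖f c‖))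
    obtain ⟨R, hR, h⟩ := Metric.eventually_nhds_iff_ball.1 this
    exact ⟨R, hR, fun z hz => (h z hz).le⟩
  have hr : 0 < R / 4 := by linarith
  rw [ContinuousAt, tendsto_iff_norm_sub_tendsto_zero]
  refine squeeze_zero' (g := fun x => 2 * (‖f c‖ + 1) / (R/4) ^ 2 * ‖x - c‖) (Eventually.of_forall fun _ => norm_nonneg _) ?_ ?_
  · filter_upwards [ball_mem_nhds c hr] with x hx
    exact cx_lip_fderiv hf hr (fun z hz => hb z (by convert hz using 2; ring)) hx (mem_ball_self hr)
  · have : Continuous fun x => 2 * (‖f c‖ + 1) / (R/4) ^ 2 * ‖x - c‖ := by fun_prop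
    simpa using this.tendsto c

lemma cx_line {f : E → F} (hf : Differentiable ℂ f) (z v : E) :
    Differentiable ℂ (fun t : ℂ => f (z + t • v)) := hf.comp (by fun_prop)

lemma cx_line_deriv {f : E → F} (hf : Differentiable ℂ f) (z v : E) (t : ℂ) :
    HasDerivAt (fun t : ℂ => f (z + t • v)) (fderiv ℂ f (z + t • v) v) t := by
  have h1 : HasDerivAt (fun t : ℂ => z + t • v) v t := by
    simpa using ((hasDerivAt_id t).smul_const v).const_add z
  exact (hf _).hasFDerivAt.comp_hasDerivAt t h1

lemma cx_identity [CompleteSpace F] {f g : E → F} (hf : Differentiable ℂ f) (hg : Differentiable ℂ g) {c : E} {r : ℝ}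
    (hr : 0 < r) (h : ∀ z ∈ ball c r, f z = g z) : f = g := by
  funext z
  have h1 := (cx_line hf c (z - c)).differentiableOn.analyticOnNhd isOpen_univ
  have h2 := (cx_line hg c (z - c)).differentiableOn.analyticOnNhd isOpen_univ
  have := h1.eqOn_of_preconnected_of_eventuallyEq h2 isPreconnected_univ (mem_univ (0:ℂ)) ?_ (mem_univ (1:ℂ))
  · simpa using this
  · have hc : ContinuousAt (fun t : ℂ => c + t • (z - c)) 0 := by fun_prop
    have : ∀ᶠ t in 𝓝 (0:ℂ), c + t • (z - c) ∈ ball c r := hc.eventually_mem (by simpa using ball_mem_nhds c hr)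
    filter_upwards [this] with t ht using h _ ht

lemma cx_dir_diff [ProperSpace E] [CompleteSpace F] {f : E → F} (hf : Differentiable ℂ f) (v : E) :
    Differentiable ℂ (fun z => fderiv ℂ f z v) := by
  set c : ℝ → ℂ := circleMap 0 1 with hc
  have hcc : Continuous c := continuous_circleMap 0 1
  set w : ℝ → ℂ := fun θ => (c θ * Complex.I) * ((c θ - 0)^2)⁻¹ with hw
  have hcne : ∀ θ, c θ ≠ 0 := fun θ => by simp [hc]
  have hwc : Continuous w := by
    refine Continuous.mul (by fun_prop) (Continuous.inv₀ (by fun_prop) fun θ => ?_)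
    simpa using hcne θ
  have e : (fun z => fderiv ℂ f z v) = fun z => (2 * Real.pi * Complex.I : ℂ)⁻¹ •
      ∫ θ in (0:ℝ)..2 * Real.pi, w θ • f (z + c θ • v) := by
    funext z
    have h1 := Complex.two_pi_I_inv_smul_circleIntegral_sub_sq_inv_smul_of_differentiable isOpen_univ
      (c := (0:ℂ)) (R := 1) (w₀ := 0) (subset_univ _) (cx_line hf z v).differentiableOn (by simp)
    rw [(cx_line_deriv hf z v 0).deriv] at h1
    rw [zero_smul, add_zero] at h1
    rw [← h1, circleIntegral]
    congr 1
    refine intervalIntegral.integral_congr fun θ _ => ?_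
    simp only [deriv_circleMap, hw, smul_smul, hc]
  rw [e]
  refine Differentiable.const_smul ?_ _
  intro z0
  have hcont : Continuous fun q : E × ℝ => w q.2 • fderiv ℂ f (q.1 + c q.2 • v) := by
    have := cx_cont_fderiv hf
    exact (hwc.comp continuous_snd).smul (this.comp (by fun_prop))
  obtain ⟨B, hB⟩ := ((isCompact_closedBall z0 1).prod (isCompact_uIcc (a := (0:ℝ)) (b := 2 * Real.pi))).exists_bound_of_continuousOn
    hcont.continuousOn
  have hcf := hf.continuous
  clear_value w c
  clear e
  refine (intervalIntegral.hasFDerivAt_integral_of_dominated_of_fderiv_le (𝕜 := ℂ) (s := closedBall z0 1)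
    (μ := MeasureTheory.volume) (x₀ := z0) (a := 0) (b := 2 * Real.pi)
    (F := fun z θ => w θ • f (z + c θ • v)) (F' := fun z θ => w θ • fderiv ℂ f (z + c θ • v))
    (bound := fun _ => B) (closedBall_mem_nhds z0 one_pos) ?_ ?_ ?_ ?_ ?_ ?_).differentiableAt
  · refine Eventually.of_forall fun z => Continuous.aestronglyMeasurable ?_
    exact hwc.smul (hcf.comp (by fun_prop))
  · refine Continuous.intervalIntegrable ?_ _ _
    exact hwc.smul (hcf.comp (by fun_prop))
  · refine Continuous.aestronglyMeasurable ?_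
    exact hcont.comp (by fun_prop : Continuous fun θ : ℝ => (z0, θ))
  · refine Eventually.of_forall fun θ hθ z hz => ?_
    exact hB (z, θ) ⟨hz, uIoc_subset_uIcc hθ⟩
  · simp
  · refine Eventually.of_forall fun θ hθ z hz => ?_
    have h1 : HasFDerivAt (fun z => f (z + c θ • v)) (fderiv ℂ f (z + c θ • v)) z := by
      have := (hf (z + c θ • v)).hasFDerivAt.comp z ((hasFDerivAt_id z).add_const (c θ • v))
      simpa [Function.comp_def] using this
    exact h1.const_smul (w θ)

/-- three circles -/
lemma cx_three {f : E → F} (hf : Differentiable ℂ f) {c : E} {r a M : ℝ} (hr : 0 < r) (ha0 : 0 < a) (haM : a ≤ M)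
    (ha : ∀ z ∈ closedBall c r, ‖f z‖ ≤ a) (hM : ∀ z ∈ closedBall c (r * Real.exp 4), ‖f z‖ ≤ M) :
    ∀ z ∈ closedBall c (r * Real.exp 1), ‖f z‖ ≤ a ^ (3/4 : ℝ) * M ^ (1/4 : ℝ) := by
  intro z hz
  have hM0 : 0 < M := ha0.trans_le haM
  have hfin : ∀ s : ℝ, 0 ≤ s → s ≤ 1/4 → a ^ (1 - s) * M ^ s ≤ a ^ (3/4 : ℝ) * M ^ (1/4 : ℝ) := by
    intro s hs0 hs
    have e1 : a ^ (1 - s) = a ^ (3/4 : ℝ) * a ^ (1/4 - s) := by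
      rw [← Real.rpow_add ha0]; congr 1; ring
    have e2 : M ^ (1/4 : ℝ) = M ^ (1/4 - s) * M ^ s := by
      rw [← Real.rpow_add hM0]; congr 1; ring
    rw [e1, e2, mul_assoc]
    gcongr
  by_cases hzr : z ∈ closedBall c r
  · refine (ha z hzr).trans ?_
    simpa using hfin 0 le_rfl (by norm_num)
  rw [mem_closedBall, dist_eq_norm] at hz hzr
  push Not at hzr
  have hzp : 0 < ‖z - c‖ := hr.trans hzr
  set u : E := ((r / ‖z - c‖ : ℝ) : ℂ) • (z - c) with hu
  have hun : ‖u‖ = r := by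
    rw [hu, norm_smul, Complex.norm_real, Real.norm_of_nonneg (by positivity)]
    field_simp
  set g : ℂ → F := fun w => f (c + Complex.exp w • u) with hg
  have hgd : Differentiable ℂ g := (cx_line hf c u).comp Complex.differentiable_exp
  have hdist : ∀ w : ℂ, dist (c + Complex.exp w • u) c = r * Real.exp w.re := by
    intro w
    rw [dist_eq_norm, add_sub_cancel_left, norm_smul, hun, Complex.norm_exp, mul_comm]
  set L := Real.log (‖z - c‖ / r) with hL
  have hL0 : 0 ≤ L := Real.log_nonneg (by rw [le_div_iff₀ hr]; linarith)
  have hL1 : L ≤ 1 := by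
    rw [hL, Real.log_le_iff_le_exp (by positivity), div_le_iff₀ hr]; linarith
  have key := Complex.HadamardThreeLines.norm_le_interp_of_mem_verticalClosedStrip' (f := g) (z := (L : ℂ))
    (a := a) (b := M) (l := 0) (u := 4) (by norm_num) ?_ hgd.diffContOnCl ?_ ?_ ?_
  · have e : g L = f z := by
      simp only [hg]
      congr 1
      rw [← Complex.ofReal_exp, hL, Real.exp_log (by positivity), hu, smul_smul, ← Complex.ofReal_mul]
      have : ‖z - c‖ / r * (r / ‖z - c‖) = 1 := by field_simp
      rw [this]; simp
    rw [e] at key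
    refine key.trans ?_
    have := hfin (L / 4) (by positivity) (by linarith)
    simpa using this
  · simp only [Complex.HadamardThreeLines.verticalClosedStrip, mem_preimage, Complex.ofReal_re, mem_Icc]
    constructor <;> linarith
  · refine ⟨M, ?_⟩
    rintro _ ⟨w, hw, rfl⟩
    refine hM _ ?_
    rw [mem_closedBall, hdist]
    simp only [Complex.HadamardThreeLines.verticalClosedStrip, mem_preimage, mem_Icc] at hw
    gcongr
    exact hw.2
  · intro w hw
    refine ha _ ?_
    rw [mem_closedBall, hdist]
    simp only [mem_preimage, mem_singleton_iff] at hw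
    simp [hw]
  · intro w hw
    refine hM _ ?_
    rw [mem_closedBall, hdist]
    simp only [mem_preimage, mem_singleton_iff] at hw
    simp [hw]
end CX


lemma en_sum_coord {n : ℕ} (z : En n) : z = ∑ i, z i • (EuclideanSpace.single i (1:ℂ) : En n) := by
  ext j
  simp [Finset.sum_apply, Pi.single_apply]

structure PolyClosed {n : ℕ} (W : (En n → ℂ) → Prop) : Prop where
  one : W (fun _ => 1)
  add : ∀ f g, W f → W g → W (fun z => f z + g z)
  smul : ∀ (c : ℂ) f, W f → W (fun z => c * f z)
  coord : ∀ i f, W f → W (fun z => z i * f z)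

lemma PolyClosed.sum {n : ℕ} {W : (En n → ℂ) → Prop} (hW : PolyClosed W) {ι : Type*} (s : Finset ι)
    (f : ι → En n → ℂ) (h : ∀ i ∈ s, W (f i)) : W (fun z => ∑ i ∈ s, f i z) := by
  classical
  induction s using Finset.induction_on with
  | empty => simpa using hW.smul 0 _ hW.one
  | insert a s ha ih =>
    simp only [Finset.sum_insert ha]
    exact hW.add _ _ (h a (by simp)) (ih fun i hi => h i (by simp [hi]))

lemma poly_hom {n : ℕ} {W : (En n → ℂ) → Prop} (hW : PolyClosed W) (d : ℕ) :
    ∀ h : En n → ℂ, Differentiable ℂ h → (∀ c : ℂ, c ≠ 0 → ∀ z, h (c • z) = c ^ d * h z) → W h := by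
  induction d with
  | zero =>
    intro h hd hh
    have : h = fun z => h 0 * 1 := by
      funext z
      have h1 : Tendsto (fun c : ℂ => h (c • z)) (𝓝[≠] 0) (𝓝 (h 0)) := by
        have : Continuous fun c : ℂ => h (c • z) := hd.continuous.comp (by fun_prop)
        have := (this.tendsto 0).mono_left (nhdsWithin_le_nhds (s := {0}ᶜ))
        simpa using this
      have h2 : Tendsto (fun c : ℂ => h (c • z)) (𝓝[≠] 0) (𝓝 (h z)) := by
        refine tendsto_const_nhds.congr' ?_
        filter_upwards [self_mem_nhdsWithin] with c hc
        rw [hh c hc]; simp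
      rw [mul_one]
      exact tendsto_nhds_unique h2 h1
    rw [this]
    exact hW.smul _ _ hW.one
  | succ d ih =>
    intro h hd hh
    have hder : ∀ v, W (fun z => fderiv ℂ h z v) := by
      intro v
      refine ih _ (cx_dir_diff hd v) ?_
      intro c hc z
      have h1 := cx_line_deriv hd (c • z) (c • v) 0
      have h2 := (cx_line_deriv hd z v 0).const_mul (c ^ (d+1))
      have e : (fun t : ℂ => h (c • z + t • c • v)) = fun t : ℂ => c ^ (d+1) * h (z + t • v) := by
        funext t
        rw [← hh c hc]; congr 1; rw [smul_add, smul_comm t c]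
      rw [e] at h1
      have := h1.unique h2
      simp only [zero_smul, add_zero, map_smul, smul_eq_mul] at this
      have h3 : c * fderiv ℂ h (c • z) v = c * (c ^ d * fderiv ℂ h z v) := by rw [this]; ring
      exact mul_left_cancel₀ hc h3
    have heu : h = fun z => ((d:ℂ) + 1)⁻¹ * ∑ i, z i * fderiv ℂ h z (EuclideanSpace.single i (1:ℂ)) := by
      funext z
      have h1 := cx_line_deriv hd 0 z 1
      simp only [zero_add, one_smul] at h1
      have h2 : HasDerivAt (fun t : ℂ => h (t • z)) (((d:ℂ)+1) * h z) 1 := by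
        have h3 : HasDerivAt (fun t : ℂ => t ^ (d+1) * h z) (((d:ℂ)+1) * h z) 1 := by
          have := (hasDerivAt_pow (d+1) (1:ℂ)).mul_const (h z)
          simpa using this
        refine h3.congr_of_eventuallyEq ?_
        filter_upwards [isOpen_ne.mem_nhds (one_ne_zero (α := ℂ))] with t ht using hh t ht z
      have h4 := h1.unique h2
      have h5 : fderiv ℂ h z z = ∑ i, z i * fderiv ℂ h z (EuclideanSpace.single i (1:ℂ)) := by
        conv_lhs => rw [en_sum_coord z]
        rw [map_sum]
        refine Finset.sum_congr rfl fun i _ => ?_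
        rw [map_smul, smul_eq_mul, ← en_sum_coord z]
      rw [← h5, h4]
      have : (d:ℂ) + 1 ≠ 0 := by exact_mod_cast Nat.succ_ne_zero d
      field_simp
    rw [heu]
    exact hW.smul _ _ (hW.sum _ _ fun i _ => hW.coord _ _ (hder _))

lemma poly_approx {n : ℕ} {W : (En n → ℂ) → Prop} (hW : PolyClosed W) {H : En n → ℂ}
    (hH : Differentiable ℂ H) (R : ℝ) {ε : ℝ} (hε : 0 < ε) :
    ∃ g, W g ∧ ∀ z, ‖z‖ ≤ R → ‖g z - H z‖ ≤ ε := by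
  obtain ⟨Φ, hΦ0, hΦd, hΦs⟩ : ∃ Φ : ℕ → En n × ℂ → ℂ, (∀ z ζ, Φ 0 (z, ζ) = H (ζ • z)) ∧
      (∀ d, Differentiable ℂ (Φ d)) ∧ ∀ d q, Φ (d+1) q = fderiv ℂ (Φ d) q (0, 1) := by
    let Φ : ℕ → En n × ℂ → ℂ := fun d => Nat.rec (fun q => H (q.2 • q.1)) (fun _ φ q => fderiv ℂ φ q (0, 1)) d
    refine ⟨Φ, fun _ _ => rfl, fun d => ?_, fun _ _ => rfl⟩
    induction d with
    | zero => exact hH.comp (by fun_prop)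
    | succ d ih => exact cx_dir_diff ih _
  have hiter : ∀ d (z : En n) (ζ : ℂ), iteratedDeriv d (fun ζ : ℂ => H (ζ • z)) ζ = Φ d (z, ζ) := by
    intro d z
    induction d with
    | zero => intro ζ; simp [hΦ0]
    | succ d ih =>
      intro ζ
      rw [iteratedDeriv_succ, funext ih]
      have := (cx_line_deriv (hΦd d) (z, 0) (0, 1) ζ).deriv
      simp only [Prod.smul_mk, smul_zero, smul_eq_mul, mul_one, Prod.mk_add_mk, add_zero, zero_add] at this
      rw [this, hΦs]
  have hsd : ∀ z : En n, Differentiable ℂ (fun ζ : ℂ => H (ζ • z)) := fun z => by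
    simpa using cx_line hH 0 z
  have hWd : ∀ d, W (fun z => Φ d (z, 0)) := by
    intro d
    refine poly_hom hW d _ ((hΦd d).comp (by fun_prop)) ?_
    intro c hc z
    rw [← hiter, ← hiter]
    have := congrFun (iteratedDeriv_comp_const_mul (n := d) (f := fun ζ : ℂ => H (ζ • z)) (hsd z).contDiff c) 0
    simp only [mul_zero, smul_eq_mul] at this
    rw [← this]
    congr 1
    funext t
    rw [smul_smul, mul_comm]
  obtain ⟨M, hM⟩ := (isCompact_closedBall (0 : En n) (2 * R)).exists_bound_of_continuousOn hH.continuous.continuousOn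
  obtain ⟨N, hN⟩ := ((tendsto_pow_atTop_nhds_zero_of_lt_one (r := (1/2:ℝ)) (by norm_num) (by norm_num)).const_mul (2 * M)).eventually
    (gt_mem_nhds (by simpa using hε)) |>.exists
  refine ⟨fun z => ∑ d ∈ Finset.range N, ((d.factorial : ℂ)⁻¹ * Φ d (z, 0)), hW.sum _ _ fun d _ => hW.smul _ _ (hWd d), ?_⟩
  intro z hz
  have hs := Complex.hasSum_taylorSeries_of_entire (hsd z) 0 1
  simp only [sub_zero, one_pow, one_smul, smul_eq_mul, hiter, one_mul] at hs
  have hb : ∀ d : ℕ, ‖(d.factorial : ℂ)⁻¹ * Φ d (z, 0)‖ ≤ M * (1/2)^d := by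
    intro d
    have := Complex.norm_iteratedDeriv_le_of_forall_mem_sphere_norm_le d (c := 0) (R := 2) (C := M) (by norm_num) (hsd z).diffContOnCl ?_
    · rw [hiter] at this
      rw [norm_mul, norm_inv, Complex.norm_natCast, inv_mul_le_iff₀ (by positivity)]
      refine this.trans (le_of_eq ?_)
      rw [div_pow, one_pow]; ring
    · intro ζ hζ
      refine hM _ ?_
      simp only [mem_sphere, dist_zero_right, mem_closedBall, norm_smul] at *
      rw [hζ]; linarith
  have := norm_sub_le_of_geometric_bound_of_hasSum (by norm_num) hb hs N
  refine this.trans ?_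
  have e : M * (1/2:ℝ)^N / (1 - 1/2) = 2 * M * (1/2)^N := by ring
  rw [e]; exact hN.le


lemma inv_bound (n : ℕ) (C : ℝ) : ∃ C' : ℝ, ∀ A B : En n →L[ℂ] En n, A.det = 1 → ‖A‖ ≤ C →
    B.comp A = ContinuousLinearMap.id ℂ _ → A.comp B = ContinuousLinearMap.id ℂ _ → ‖B‖ ≤ C' := by
  have hK : IsCompact {A : En n →L[ℂ] En n | ‖A‖ ≤ C ∧ A.det = 1} := by
    have : {A : En n →L[ℂ] En n | ‖A‖ ≤ C ∧ A.det = 1} = closedBall 0 C ∩ {A | A.det = 1} := by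
      ext A; simp
    rw [this]
    have : ProperSpace (En n →L[ℂ] En n) := FiniteDimensional.proper ℂ _
    exact (isCompact_closedBall 0 C).inter_right (isClosed_eq ContinuousLinearMap.continuous_det continuous_const)
  have hc : ContinuousOn (fun A : En n →L[ℂ] En n => Ring.inverse A) {A : En n →L[ℂ] En n | ‖A‖ ≤ C ∧ A.det = 1} := by
    intro A hA
    have hu : IsUnit A := by
      have h1 : IsUnit (A : En n →ₗ[ℂ] En n).det := by
        have : (A : En n →ₗ[ℂ] En n).det = 1 := hA.2
        rw [this]; exact isUnit_one
      have := ((A : En n →ₗ[ℂ] En n).equivOfDetNeZero h1.ne_zero).toContinuousLinearEquiv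
      have e : A = (((A : En n →ₗ[ℂ] En n).equivOfDetNeZero h1.ne_zero).toContinuousLinearEquiv : En n →L[ℂ] En n) := by
        ext x; simp [LinearMap.equivOfDetNeZero]
      rw [e]
      generalize ((A : En n →ₗ[ℂ] En n).equivOfDetNeZero h1.ne_zero).toContinuousLinearEquiv = e'
      exact ⟨⟨(e' : En n →L[ℂ] En n), (e'.symm : En n →L[ℂ] En n), by ext1 x; simp, by ext1 x; simp⟩, rfl⟩
    obtain ⟨u, rfl⟩ := hu
    exact (NormedRing.inverse_continuousAt u).continuousWithinAt
  obtain ⟨C', hC'⟩ := hK.exists_bound_of_continuousOn hc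
  refine ⟨C', fun A B hA hn hBA hAB => ?_⟩
  have : Ring.inverse A = B := by
    exact Ring.inverse_unit (⟨A, B, hAB, hBA⟩ : (En n →L[ℂ] En n)ˣ)
  rw [← this]
  exact hC' A ⟨hn, hA⟩

lemma trace_bound (n : ℕ) : ∃ C : ℝ, 0 ≤ C ∧ ∀ A : En n →L[ℂ] En n, (ContinuousLinearMap.id ℂ _ + A).det = 1 → ‖A‖ < 1 →
    ‖LinearMap.trace ℂ _ (A : En n →ₗ[ℂ] En n)‖ ≤ C * ‖A‖ ^ 2 := by
  have : ProperSpace (En n →L[ℂ] En n) := FiniteDimensional.proper ℂ _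
  obtain ⟨M, hM⟩ := (isCompact_closedBall (0 : En n →L[ℂ] En n) 2).exists_bound_of_continuousOn
    (f := ContinuousLinearMap.det) ContinuousLinearMap.continuous_det.continuousOn
  have hM0 : 0 ≤ M := (norm_nonneg _).trans (hM 0 (by simp))
  refine ⟨4 * M, by positivity, fun A hA hA1 => ?_⟩
  by_cases hA0 : A = 0
  · simp [hA0]
  have hAp : 0 < ‖A‖ := norm_pos_iff.2 hA0
  set q : ℂ → ℂ := fun t => (ContinuousLinearMap.id ℂ _ + t • A).det with hq
  set b := EuclideanSpace.basisFun (Fin n) ℂ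
  set m := LinearMap.toMatrix b.toBasis b.toBasis (A : En n →ₗ[ℂ] En n) with hm
  have hqm : ∀ t, q t = (1 + t • m).det := by
    intro t
    have : q t = LinearMap.det ((LinearMap.id : En n →ₗ[ℂ] En n) + t • (A : En n →ₗ[ℂ] En n)) := rfl
    rw [this, ← LinearMap.det_toMatrix b.toBasis]
    rw [map_add, map_smul, LinearMap.toMatrix_id]
  have hqd : HasDerivAt q (LinearMap.trace ℂ _ (A : En n →ₗ[ℂ] En n)) 0 := by
    have e : q = fun t => 1 + m.trace * t + (Matrix.det (1 + (Polynomial.X : Polynomial ℂ) • m.map Polynomial.C)).divX.divX.eval t * t ^ 2 := by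
      funext t; rw [hqm, Matrix.det_one_add_smul]
    rw [e, LinearMap.trace_eq_matrix_trace ℂ b.toBasis]
    set P := (Matrix.det (1 + (Polynomial.X : Polynomial ℂ) • m.map Polynomial.C)).divX.divX
    have h1 : HasDerivAt (fun t : ℂ => 1 + m.trace * t) m.trace 0 := by
      simpa using ((hasDerivAt_id (0:ℂ)).const_mul m.trace).const_add 1
    have h2 := (P.hasDerivAt 0).fun_mul (hasDerivAt_pow 2 (0:ℂ))
    refine (h1.fun_add h2).congr_deriv ?_
    simp [hm]
  have hqdiff : Differentiable ℂ q := by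
    have e : q = fun t => 1 + m.trace * t + (Matrix.det (1 + (Polynomial.X : Polynomial ℂ) • m.map Polynomial.C)).divX.divX.eval t * t ^ 2 := by
      funext t; rw [hqm, Matrix.det_one_add_smul]
    rw [e]
    fun_prop
  have key := cx_taylor2 hqdiff (c := 0) (z := 1) (r := 1 / ‖A‖) (M := M) (by positivity) ?_ ?_
  · have e1 : q 1 = 1 := by simp [hq, hA]
    have e0 : q 0 = 1 := by
      simp [hqm]
    rw [e1, e0, sub_self, zero_sub, norm_neg, sub_zero, hqd.hasFDerivAt.fderiv] at key
    simpa using key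
  · intro t ht
    refine hM _ ?_
    simp only [mem_ball, mem_closedBall, dist_zero_right] at *
    have : ‖t‖ * ‖A‖ ≤ 1 := by
      rw [lt_div_iff₀ hAp] at ht; exact ht.le
    calc _ ≤ ‖ContinuousLinearMap.id ℂ (En n)‖ + ‖t • A‖ := norm_add_le _ _
      _ ≤ 1 + ‖t‖ * ‖A‖ := by
        rw [norm_smul]; gcongr; exact ContinuousLinearMap.norm_id_le
      _ ≤ 2 := by linarith
  · simp only [mem_ball, dist_zero_right, norm_one]
    rw [lt_div_iff₀ hAp]; linarith

lemma fp_lemma {E : Type*} [NormedAddCommGroup E] [NormedSpace ℂ E] [CompleteSpace E] {Ψ : E → E} (hd : Differentiable ℂ Ψ) {p : E} {s : ℝ}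
    (hs : 0 ≤ s) (h1 : ∀ x ∈ closedBall p s, ‖fderiv ℂ Ψ x‖ ≤ 1/2) (h2 : ‖Ψ p - p‖ ≤ s / 2) :
    ∃ x ∈ closedBall p s, Ψ x = x := by
  have hlip : ∀ x ∈ closedBall p s, ∀ y ∈ closedBall p s, ‖Ψ x - Ψ y‖ ≤ 1/2 * ‖x - y‖ := fun x hx y hy =>
    (convex_closedBall p s).norm_image_sub_le_of_norm_fderiv_le (𝕜 := ℂ) (fun z _ => hd z) h1 hy hx
  have hps : p ∈ closedBall p s := mem_closedBall_self hs
  have hmaps : MapsTo Ψ (closedBall p s) (closedBall p s) := by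
    intro x hx
    have := hlip x hx p hps
    rw [mem_closedBall, dist_eq_norm] at *
    calc ‖Ψ x - p‖ = ‖(Ψ x - Ψ p) + (Ψ p - p)‖ := by congr 1; abel
      _ ≤ _ := norm_add_le _ _
      _ ≤ s := by linarith
  have hc : ContractingWith (1/2) (hmaps.restrict Ψ _ _) := by
    refine ⟨by rw [div_lt_one (by norm_num)]; norm_num, LipschitzWith.of_dist_le_mul ?_⟩
    rintro ⟨x, hx⟩ ⟨y, hy⟩
    have := hlip x hx y hy
    simpa [Subtype.dist_eq, dist_eq_norm] using this
  obtain ⟨y, hy, hfy, -⟩ := hc.exists_fixedPoint' isClosed_closedBall.isComplete hmaps hps (edist_ne_top _ _)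
  exact ⟨y, hy, hfy⟩


structure Trap {n : ℕ} (h g : En n → En n) (p0 : En n) (ρ R : ℝ) : Prop where
  hd : Differentiable ℂ h
  gd : Differentiable ℂ g
  gh : LeftInverse g h
  hg : RightInverse g h
  vol : ∀ z, (fderiv ℂ h z).det = 1
  pos : 0 < ρ
  shear : ∀ (φ : ℂ → ℂ) (l : En n →L[ℂ] ℂ) (v : En n), Differentiable ℂ φ → l v = 0 → ∃ δ > 0, ∀ t : ℂ, ‖t‖ < δ →
    ∀ p ∈ ball p0 ρ, ∀ k : ℕ, ‖(fun z => h z + (t * φ (l (h z))) • v)^[k] p‖ ≤ R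

lemma diff_iter {n : ℕ} {h : En n → En n} (hd : Differentiable ℂ h) (j : ℕ) : Differentiable ℂ (h^[j]) := hd.iterate j

lemma fderiv_iter_add {n : ℕ} {h : En n → En n} (hd : Differentiable ℂ h) (j m : ℕ) (p : En n) :
    fderiv ℂ (h^[j+m]) p = (fderiv ℂ (h^[j]) (h^[m] p)).comp (fderiv ℂ (h^[m]) p) := by
  rw [iterate_add]
  exact fderiv_comp p (hd.iterate j _) (hd.iterate m _)

lemma det_iter {n : ℕ} {h : En n → En n} (hd : Differentiable ℂ h) (hv : ∀ z, (fderiv ℂ h z).det = 1) (j : ℕ) (p : En n) :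
    (fderiv ℂ (h^[j]) p).det = 1 := by
  induction j generalizing p with
  | zero =>
    rw [iterate_zero, fderiv_id]
    exact LinearMap.det_id
  | succ j ih =>
    rw [fderiv_iter_add hd j 1]
    have := LinearMap.det_comp (fderiv ℂ (h^[j]) (h^[1] p) : En n →ₗ[ℂ] En n) (fderiv ℂ (h^[1]) p : En n →ₗ[ℂ] En n)
    refine this.trans ?_
    have h1 := ih (h^[1] p)
    have h2 := hv p
    simp only [ContinuousLinearMap.det, iterate_one] at h1 h2 ⊢
    rw [h1, h2, one_mul]

namespace Trap
variable {n : ℕ} {h g : En n → En n} {p0 : En n} {ρ R : ℝ}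

lemma bdd (H : Trap h g p0 ρ R) (k : ℕ) (p : En n) (hp : p ∈ ball p0 ρ) : ‖h^[k] p‖ ≤ R := by
  obtain ⟨δ, hδ, hh⟩ := H.shear 0 0 0 (differentiable_const 0) (by simp)
  have := hh 0 (by simpa) p hp k
  simpa using this

lemma R0 (H : Trap h g p0 ρ R) : 0 ≤ R := (norm_nonneg _).trans (H.bdd 0 p0 (mem_ball_self H.pos))

lemma TD (H : Trap h g p0 ρ R) (j : ℕ) (p : En n) :
    (fderiv ℂ (g^[j]) (h^[j] p)).comp (fderiv ℂ (h^[j]) p) = ContinuousLinearMap.id ℂ _ := by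
  rw [← fderiv_comp p (H.gd.iterate j _) (H.hd.iterate j _)]
  have : g^[j] ∘ h^[j] = id := funext (H.gh.iterate j)
  rw [this, fderiv_id]

lemma DT (H : Trap h g p0 ρ R) (j : ℕ) (p : En n) :
    (fderiv ℂ (h^[j]) p).comp (fderiv ℂ (g^[j]) (h^[j] p)) = ContinuousLinearMap.id ℂ _ := by
  have e : g^[j] (h^[j] p) = p := H.gh.iterate j p
  have := fderiv_comp (h^[j] p) (H.hd.iterate j (g^[j] (h^[j] p))) (H.gd.iterate j _)
  rw [e] at this
  rw [← this]
  have : h^[j] ∘ g^[j] = id := funext (H.hg.iterate j)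
  rw [this, fderiv_id]

lemma T_add (H : Trap h g p0 ρ R) (j m : ℕ) (p : En n) :
    (fderiv ℂ (g^[j+m]) (h^[j+m] p)).comp (fderiv ℂ (h^[m]) (h^[j] p)) = fderiv ℂ (g^[j]) (h^[j] p) := by
  have h1 := H.TD (j+m) p
  rw [add_comm j m, fderiv_iter_add H.hd m j, ← ContinuousLinearMap.comp_assoc, add_comm m j] at h1
  have h2 := congrArg (fun A => ContinuousLinearMap.comp A (fderiv ℂ (g^[j]) (h^[j] p))) h1
  simp only [ContinuousLinearMap.comp_assoc] at h2
  rw [H.DT j p, ContinuousLinearMap.comp_id, ContinuousLinearMap.id_comp] at h2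
  exact h2

lemma consts (H : Trap h g p0 ρ R) : ∃ C : ℝ, 1 ≤ C ∧ ∀ j : ℕ, ∀ p ∈ ball p0 (ρ/4),
    ‖fderiv ℂ (h^[j]) p‖ ≤ C ∧ ‖fderiv ℂ (g^[j]) (h^[j] p)‖ ≤ C ∧
    (∀ z ∈ ball p0 (ρ/4), ‖h^[j] z - h^[j] p - fderiv ℂ (h^[j]) p (z - p)‖ ≤ C * ‖z - p‖^2) ∧
    (∀ z ∈ ball p0 (ρ/4), ‖fderiv ℂ (h^[j]) z - fderiv ℂ (h^[j]) p‖ ≤ C * ‖z - p‖) := by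
  have hρ := H.pos
  obtain ⟨C', hC'⟩ := inv_bound n (2 * R / (ρ/2))
  set c1 := 2 * R / (ρ/2)
  set c2 := 4 * R / (ρ/2)^2
  set c3 := 2 * R / (ρ/4)^2
  refine ⟨max (max 1 C') (max c1 (max c2 c3)), by simp, fun j p hp => ?_⟩
  have hb : ∀ z ∈ ball p (ρ/2), ‖h^[j] z‖ ≤ R := fun z hz => H.bdd j z (by
    simp only [mem_ball] at *
    linarith [dist_triangle z p p0])
  have h1 : ‖fderiv ℂ (h^[j]) p‖ ≤ c1 := cx_cauchy (H.hd.iterate j) (by linarith) hb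
  have h2 : ‖fderiv ℂ (g^[j]) (h^[j] p)‖ ≤ C' := hC' _ _ (det_iter H.hd H.vol j p) h1 (H.TD j p) (H.DT j p)
  refine ⟨h1.trans (by simp), h2.trans (by simp), fun z hz => ?_, fun z hz => ?_⟩
  · have := cx_taylor2 (H.hd.iterate j) (by linarith : 0 < ρ/2) hb (z := z) (by
      simp only [mem_ball] at *
      linarith [dist_triangle_right z p p0])
    refine this.trans ?_
    gcongr
    exact (le_max_left c2 c3).trans ((le_max_right _ _).trans (le_max_right _ _))
  · have := cx_lip_fderiv (H.hd.iterate j) (c := p0) (x := z) (y := p) (M := R) (by linarith : 0 < ρ/4)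
      (fun w hw => H.bdd j w (by simpa [mul_div_cancel₀] using hw)) hz hp
    refine this.trans ?_
    gcongr
    exact (le_max_right c2 c3).trans ((le_max_right _ _).trans (le_max_right _ _))

end Trap

def bsum {n : ℕ} (h g : En n → En n) (X : En n → En n) (p : En n) (k : ℕ) : En n :=
  ∑ j ∈ Finset.range k, fderiv ℂ (g^[j+1]) (h^[j+1] p) (X (h^[j+1] p))

namespace Trap
variable {n : ℕ} {h g : En n → En n} {p0 : En n} {ρ R : ℝ}

lemma shear_bdd (H : Trap h g p0 ρ R) (φ : ℂ → ℂ) (l : En n →L[ℂ] ℂ) (v : En n) (hφ : Differentiable ℂ φ) (hl : l v = 0) :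
    ∃ B : ℝ, ∀ p ∈ ball p0 (ρ/4), ∀ k, ‖bsum h g (fun z => φ (l z) • v) p k‖ ≤ B := by
  obtain ⟨C, hC1, hC⟩ := H.consts
  obtain ⟨δ, hδ, hs⟩ := H.shear φ l v hφ hl
  refine ⟨C * (2 * R / δ), fun p hp k => ?_⟩
  have hρ := H.pos
  have hpρ : p ∈ ball p0 ρ := ball_subset_ball (by linarith) hp
  set y : ℕ → ℂ → En n := fun k t => (fun z => h z + (t * φ (l (h z))) • v)^[k] p with hy
  have hy0 : ∀ k, y k 0 = h^[k] p := by intro k; simp [hy]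
  have hys : ∀ k, y (k+1) = fun t => h (y k t) + (t * φ (l (h (y k t)))) • v := by
    intro k; funext t; simp only [hy, iterate_succ_apply']
  have hyd : ∀ k, Differentiable ℂ (y k) := by
    intro k
    induction k with
    | zero => exact differentiable_const p
    | succ k ih =>
      rw [hys]
      have h1 : Differentiable ℂ fun t => h (y k t) := H.hd.comp ih
      have h2 : Differentiable ℂ fun t => φ (l (h (y k t))) := hφ.comp (l.differentiable.comp h1)
      exact h1.add ((differentiable_id.mul h2).smul_const v)
  have hder : ∀ k, fderiv ℂ (g^[k]) (h^[k] p) (deriv (y k) 0) = bsum h g (fun z => φ (l z) • v) p k := by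
    intro k
    induction k with
    | zero => 
      have : y 0 = fun _ => p := by funext t; simp [hy]
      simp [bsum, this]
    | succ k ih =>
      have h1 : HasDerivAt (fun t => h (y k t)) (fderiv ℂ h (h^[k] p) (deriv (y k) 0)) 0 := by
        have a := (H.hd (y k 0)).hasFDerivAt.comp_hasDerivAt (0:ℂ) (hyd k 0).hasDerivAt
        rw [hy0] at a
        exact a
      have h2 : Differentiable ℂ fun t => φ (l (h (y k t))) := hφ.comp (l.differentiable.comp (H.hd.comp (hyd k)))
      have h3 : HasDerivAt (y (k+1)) (fderiv ℂ h (h^[k] p) (deriv (y k) 0) + (φ (l (h^[k+1] p))) • v) 0 := by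
        rw [hys]
        have h4 := ((hasDerivAt_id (0:ℂ)).fun_mul (h2 0).hasDerivAt).smul_const v
        refine (h1.fun_add h4).congr_deriv ?_
        simp only [id, hy0, one_mul, zero_mul, add_zero, iterate_succ_apply']
      rw [h3.deriv, map_add, bsum, Finset.sum_range_succ]
      change _ = bsum h g (fun z => φ (l z) • v) p k + _
      rw [← ih]
      congr 1
      have := H.T_add k 1 p
      rw [← this]
      simp
  rw [← hder]
  have hb : ‖deriv (y k) 0‖ ≤ 2 * R / δ := by
    have := cx_cauchy (hyd k) (c := 0) (M := R) hδ (fun t ht => hs t (by simpa using ht) p hpρ k)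
    rwa [← norm_deriv_eq_norm_fderiv] at this
  have hpos : 0 ≤ 2 * R / δ := (norm_nonneg _).trans hb
  refine (ContinuousLinearMap.le_opNorm _ _).trans ?_
  have := (hC k p hp).2.1
  gcongr

end Trap

def GoodX {n : ℕ} (h g : En n → En n) (p0 : En n) (ρ : ℝ) (X : En n → En n) : Prop :=
  ∀ p ∈ ball p0 (ρ/4), ∀ ε > 0, ∀ᶠ k : ℕ in atTop, ‖bsum h g X p k‖ ≤ ε * k

lemma bsum_add {n : ℕ} (h g X Y : En n → En n) (p : En n) (k : ℕ) :
    bsum h g (fun z => X z + Y z) p k = bsum h g X p k + bsum h g Y p k := by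
  simp [bsum, Finset.sum_add_distrib]

lemma bsum_smul {n : ℕ} (h g X : En n → En n) (c : ℂ) (p : En n) (k : ℕ) :
    bsum h g (fun z => c • X z) p k = c • bsum h g X p k := by
  simp [bsum, Finset.smul_sum]

lemma GoodX.add {n : ℕ} {h g : En n → En n} {p0 : En n} {ρ : ℝ} {X Y : En n → En n}
    (hX : GoodX h g p0 ρ X) (hY : GoodX h g p0 ρ Y) : GoodX h g p0 ρ (fun z => X z + Y z) := by
  intro p hp ε hε
  filter_upwards [hX p hp (ε/2) (by linarith), hY p hp (ε/2) (by linarith)] with k h1 h2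
  rw [bsum_add]
  refine (norm_add_le _ _).trans ?_
  linarith

lemma GoodX.smul {n : ℕ} {h g : En n → En n} {p0 : En n} {ρ : ℝ} {X : En n → En n}
    (hX : GoodX h g p0 ρ X) (c : ℂ) : GoodX h g p0 ρ (fun z => c • X z) := by
  intro p hp ε hε
  filter_upwards [hX p hp (ε/(‖c‖+1)) (by positivity)] with k h1
  rw [bsum_smul, norm_smul]
  calc ‖c‖ * ‖bsum h g X p k‖ ≤ (‖c‖+1) * (ε/(‖c‖+1) * k) := by gcongr; linarith
    _ = ε * k := by field_simp

lemma GoodX.sum {n : ℕ} {h g : En n → En n} {p0 : En n} {ρ : ℝ} {ι : Type*} (s : Finset ι) {X : ι → En n → En n}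
    (hX : ∀ i ∈ s, GoodX h g p0 ρ (X i)) : GoodX h g p0 ρ (fun z => ∑ i ∈ s, X i z) := by
  classical
  induction s using Finset.induction_on with
  | empty =>
    intro p hp ε hε
    refine Eventually.of_forall fun k => ?_
    simp only [bsum, Finset.sum_empty, map_zero, Finset.sum_const_zero, norm_zero]
    positivity
  | insert a s ha ih =>
    simp only [Finset.sum_insert ha]
    exact (hX a (by simp)).add (ih fun i hi => hX i (by simp [hi]))

namespace Trap
variable {n : ℕ} {h g : En n → En n} {p0 : En n} {ρ R : ℝ}

lemma good_bdd (X : En n → En n) {B : ℝ} (hB : ∀ p ∈ ball p0 (ρ/4), ∀ k, ‖bsum h g X p k‖ ≤ B) : GoodX h g p0 ρ X := by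
  intro p hp ε hε
  have : Tendsto (fun k : ℕ => ε * (k:ℝ)) atTop atTop := tendsto_natCast_atTop_atTop.const_mul_atTop hε
  filter_upwards [this.eventually_ge_atTop B] with k hk
  exact (hB p hp k).trans hk

lemma good_approx (H : Trap h g p0 ρ R) {X : En n → En n}
    (hX : ∀ ε > 0, ∃ Y, GoodX h g p0 ρ Y ∧ ∀ z, ‖z‖ ≤ R → ‖X z - Y z‖ ≤ ε) : GoodX h g p0 ρ X := by
  obtain ⟨C, hC1, hC⟩ := H.consts
  intro p hp ε hε
  obtain ⟨Y, hY, hXY⟩ := hX (ε / (2*C)) (by positivity)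
  have hρ := H.pos
  have hpρ : p ∈ ball p0 ρ := ball_subset_ball (by linarith) hp
  filter_upwards [hY p hp (ε/2) (by linarith)] with k hk
  have h1 : ‖bsum h g X p k - bsum h g Y p k‖ ≤ ε/2 * k := by
    rw [bsum, bsum, ← Finset.sum_sub_distrib]
    refine (norm_sum_le _ _).trans ?_
    calc _ ≤ ∑ j ∈ Finset.range k, ε/2 := by
          refine Finset.sum_le_sum fun j _ => ?_
          rw [← map_sub]
          refine (ContinuousLinearMap.le_opNorm _ _).trans ?_
          calc _ ≤ C * (ε / (2*C)) := by
                gcongr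
                · exact (hC (j+1) p hp).2.1
                · exact hXY _ (H.bdd _ _ hpρ)
            _ = ε/2 := by field_simp
      _ = _ := by simp [mul_comm]
  calc _ = ‖(bsum h g X p k - bsum h g Y p k) + bsum h g Y p k‖ := by congr 1; abel
    _ ≤ _ := norm_add_le _ _
    _ ≤ _ := by linarith
end Trap


def XH {n : ℕ} (i0 i : Fin n) (H : En n → ℂ) (z : En n) : En n :=
  fderiv ℂ H z (EuclideanSpace.single i0 1) • (EuclideanSpace.single i (1:ℂ) : En n)
    - fderiv ℂ H z (EuclideanSpace.single i 1) • (EuclideanSpace.single i0 (1:ℂ) : En n)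

lemma XH_add {n : ℕ} (i0 i : Fin n) {H G : En n → ℂ} (hH : Differentiable ℂ H) (hG : Differentiable ℂ G) :
    XH i0 i (fun z => H z + G z) = fun z => XH i0 i H z + XH i0 i G z := by
  funext z
  have : fderiv ℂ (fun z => H z + G z) z = fderiv ℂ H z + fderiv ℂ G z := fderiv_add (hH z) (hG z)
  simp only [XH, this, ContinuousLinearMap.add_apply, add_smul]; abel

lemma XH_smul {n : ℕ} (i0 i : Fin n) {H : En n → ℂ} (hH : Differentiable ℂ H) (c : ℂ) :
    XH i0 i (fun z => c * H z) = fun z => c • XH i0 i H z := by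
  funext z
  have : fderiv ℂ (fun z => c * H z) z = c • fderiv ℂ H z := fderiv_const_mul (hH z) c
  simp only [XH, this, ContinuousLinearMap.smul_apply, smul_sub, smul_smul, smul_eq_mul]

lemma XH_bound {n : ℕ} (i0 i : Fin n) {H : En n → ℂ} {z : En n} {c : ℝ} (hc : ‖fderiv ℂ H z‖ ≤ c) : ‖XH i0 i H z‖ ≤ 2 * c := by
  have h1 : ∀ i, ‖fderiv ℂ H z (EuclideanSpace.single i 1)‖ ≤ c := fun i => by
    have := (fderiv ℂ H z).le_opNorm (EuclideanSpace.single i 1)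
    simp only [EuclideanSpace.norm_single, norm_one, mul_one] at this
    exact this.trans hc
  refine (norm_sub_le _ _).trans ?_
  simp only [norm_smul, EuclideanSpace.norm_single, norm_one, mul_one]
  linarith [h1 i, h1 i0]

def GoodH {n : ℕ} (h g : En n → En n) (p0 : En n) (ρ : ℝ) (i0 : Fin n) (H : En n → ℂ) : Prop :=
  Differentiable ℂ H ∧ ∀ i, GoodX h g p0 ρ (XH i0 i H)

lemma GoodH.add {n : ℕ} {h g : En n → En n} {p0 : En n} {ρ : ℝ} {i0 : Fin n} {H G : En n → ℂ}
    (hH : GoodH h g p0 ρ i0 H) (hG : GoodH h g p0 ρ i0 G) : GoodH h g p0 ρ i0 (fun z => H z + G z) :=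
  ⟨hH.1.add hG.1, fun i => by rw [XH_add i0 i hH.1 hG.1]; exact (hH.2 i).add (hG.2 i)⟩

lemma GoodH.smul {n : ℕ} {h g : En n → En n} {p0 : En n} {ρ : ℝ} {i0 : Fin n} {H : En n → ℂ}
    (hH : GoodH h g p0 ρ i0 H) (c : ℂ) : GoodH h g p0 ρ i0 (fun z => c * H z) :=
  ⟨hH.1.const_mul c, fun i => by rw [XH_smul i0 i hH.1]; exact (hH.2 i).smul c⟩

namespace Trap
variable {n : ℕ} {h g : En n → En n} {p0 : En n} {ρ R : ℝ}

lemma goodH_approx (T : Trap h g p0 ρ R) {i0 : Fin n} {H : En n → ℂ} (hH : Differentiable ℂ H)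
    (hX : ∀ ε > 0, ∃ G, GoodH h g p0 ρ i0 G ∧ ∀ z, ‖z‖ ≤ R + 1 → ‖G z - H z‖ ≤ ε) : GoodH h g p0 ρ i0 H := by
  refine ⟨hH, fun i => T.good_approx fun ε hε => ?_⟩
  obtain ⟨G, hG, hGH⟩ := hX (ε/4) (by linarith)
  refine ⟨_, hG.2 i, fun z hz => ?_⟩
  have hd : Differentiable ℂ (fun z => H z + (-1) * G z) := hH.add (hG.1.const_mul _)
  have h1 := cx_cauchy hd (c := z) (r := 1) (M := ε/4) one_pos (fun w hw => by
    have : ‖w‖ ≤ R + 1 := by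
      have := norm_sub_norm_le w z
      rw [mem_ball, dist_eq_norm] at hw
      linarith
    have := hGH w this
    rw [norm_sub_rev] at this
    simpa [sub_eq_add_neg] using this)
  have h2 := XH_bound i0 i h1
  rw [XH_add i0 i hH (hG.1.const_mul _), XH_smul i0 i hG.1] at h2
  simp only [neg_smul, one_smul, ← sub_eq_add_neg] at h2
  linarith

lemma good_exp (T : Trap h g p0 ρ R) (i0 : Fin n) (l : En n →L[ℂ] ℂ) :
    GoodH h g p0 ρ i0 (fun z => Complex.exp (l z)) := by
  refine ⟨Complex.differentiable_exp.comp l.differentiable, fun i => ?_⟩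
  have e : XH i0 i (fun z => Complex.exp (l z)) = fun z => Complex.exp (l z) •
      (l (EuclideanSpace.single i0 1) • (EuclideanSpace.single i (1:ℂ) : En n) - l (EuclideanSpace.single i 1) • (EuclideanSpace.single i0 (1:ℂ) : En n)) := by
    funext z
    have : fderiv ℂ (fun z => Complex.exp (l z)) z = Complex.exp (l z) • l := (l.hasFDerivAt.cexp).fderiv
    simp only [XH, this, ContinuousLinearMap.smul_apply, smul_sub, smul_smul, smul_eq_mul]
  rw [e]
  obtain ⟨B, hB⟩ := T.shear_bdd Complex.exp l (l (EuclideanSpace.single i0 1) • (EuclideanSpace.single i (1:ℂ) : En n) - l (EuclideanSpace.single i 1) • (EuclideanSpace.single i0 (1:ℂ) : En n)) Complex.differentiable_exp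
    (by simp only [map_sub, map_smul, smul_eq_mul]; ring)
  exact good_bdd _ hB

lemma good_all (T : Trap h g p0 ρ R) (i0 : Fin n) {H : En n → ℂ} (hH : Differentiable ℂ H) : GoodH h g p0 ρ i0 H := by
  set W : (En n → ℂ) → Prop := fun f => Differentiable ℂ f ∧ ∀ l : En n →L[ℂ] ℂ, GoodH h g p0 ρ i0 (fun z => f z * Complex.exp (l z)) with hW
  have hPC : PolyClosed W := by
    refine ⟨⟨differentiable_const 1, fun l => by simpa using T.good_exp i0 l⟩, ?_, ?_, ?_⟩
    · intro f k hf hk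
      refine ⟨hf.1.add hk.1, fun l => ?_⟩
      simpa [add_mul] using (hf.2 l).add (hk.2 l)
    · intro c f hf
      refine ⟨hf.1.const_mul c, fun l => ?_⟩
      simpa [mul_assoc] using (hf.2 l).smul c
    · intro i f hf
      have hpr : Differentiable ℂ (fun z : En n => z i) := (EuclideanSpace.proj i : En n →L[ℂ] ℂ).differentiable
      refine ⟨hpr.mul hf.1, fun l => ?_⟩
      have hfe : Differentiable ℂ (fun z => f z * Complex.exp (l z)) := (hf.2 l).1
      refine T.goodH_approx ?_ fun ε hε => ?_
      · simp only [mul_assoc]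
        exact hpr.mul hfe
      obtain ⟨M, hM⟩ := (isCompact_closedBall (0 : En n) (R+1)).exists_bound_of_continuousOn hfe.continuous.continuousOn
      have hR := T.R0
      have hM0 : 0 ≤ M := (norm_nonneg _).trans (hM 0 (by simp; linarith))
      set s : ℝ := min (1/(R+1)) (ε/((M+1)*(R+1)^2)) with hs
      have hs0 : 0 < s := by positivity
      refine ⟨fun z => ((s:ℂ)⁻¹) * (f z * Complex.exp ((l + (s:ℂ) • (EuclideanSpace.proj i : En n →L[ℂ] ℂ)) z) + (-1) * (f z * Complex.exp (l z))),
        ((hf.2 _).add ((hf.2 l).smul (-1))).smul _, fun z hz => ?_⟩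
      have hzi : ‖z i‖ ≤ R + 1 := (PiLp.norm_apply_le z i).trans hz
      have hz1 : ‖(s:ℂ) * z i‖ ≤ 1 := by
        rw [norm_mul, Complex.norm_real, Real.norm_of_nonneg hs0.le]
        calc s * ‖z i‖ ≤ 1/(R+1) * (R+1) := by gcongr; exact min_le_left _ _
          _ = 1 := by field_simp
      have h1 := Complex.norm_exp_sub_one_sub_id_le hz1
      have hsc : (s:ℂ) ≠ 0 := by exact_mod_cast hs0.ne'
      have e : ((s:ℂ)⁻¹) * (f z * Complex.exp ((l + (s:ℂ) • (EuclideanSpace.proj i : En n →L[ℂ] ℂ)) z) + (-1) * (f z * Complex.exp (l z))) - z i * f z * Complex.exp (l z)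
          = (s:ℂ)⁻¹ * (f z * Complex.exp (l z)) * (Complex.exp ((s:ℂ) * z i) - 1 - (s:ℂ) * z i) := by
        have : (l + (s:ℂ) • (EuclideanSpace.proj i : En n →L[ℂ] ℂ)) z = l z + (s:ℂ) * z i := by simp
        rw [this, Complex.exp_add]
        field_simp
        ring
      rw [e, norm_mul, norm_mul, norm_inv, Complex.norm_real, Real.norm_of_nonneg hs0.le]
      have h2 := hM z (by simpa using hz)
      calc s⁻¹ * ‖f z * Complex.exp (l z)‖ * ‖Complex.exp ((s:ℂ) * z i) - 1 - (s:ℂ) * z i‖ 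
          ≤ s⁻¹ * M * ‖(s:ℂ) * z i‖^2 := by gcongr
        _ = M * s * ‖z i‖^2 := by
          rw [norm_mul, Complex.norm_real, Real.norm_of_nonneg hs0.le]; field_simp
        _ ≤ (M+1) * (ε/((M+1)*(R+1)^2)) * (R+1)^2 := by
          gcongr
          · linarith
          · exact min_le_right _ _
        _ = ε := by field_simp
  refine T.goodH_approx hH fun ε hε => ?_
  obtain ⟨f, hf, hfa⟩ := poly_approx hPC hH (R+1) hε
  exact ⟨f, by simpa using hf.2 0, hfa⟩

lemma recur (T : Trap h g p0 ρ R) {η : ℝ} (hη : 0 < η) : ∃ m ≥ 1, ∀ p ∈ closedBall p0 (ρ/8), ‖h^[m] p - p‖ ≤ η := by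
  obtain ⟨C, hC1, hC⟩ := T.consts
  have hρ := T.pos
  set s : ℝ := min η (min (1/(2*C^2)) (ρ/16)) with hs
  have hs0 : 0 < s := by positivity
  have hs1 : s ≤ 1/(2*C^2) := (min_le_right _ _).trans (min_le_left _ _)
  have hs2 : s ≤ ρ/16 := (min_le_right _ _).trans (min_le_right _ _)
  set τ : ℝ := s / (2*C) with hτ
  have hτ0 : 0 < τ := by positivity
  have hlip : ∀ j, ∀ x ∈ ball p0 (ρ/4), ∀ y ∈ ball p0 (ρ/4), ‖h^[j] x - h^[j] y‖ ≤ C * ‖x - y‖ := fun j x hx y hy =>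
    (convex_ball p0 (ρ/4)).norm_image_sub_le_of_norm_fderiv_le (𝕜 := ℂ) (fun z _ => T.hd.iterate j z) (fun z hz => (hC j z hz).1) hy hx
  have hsub : closedBall p0 (ρ/8) ⊆ ball p0 (ρ/4) := closedBall_subset_ball (by linarith)
  obtain ⟨N, hNs, hNf, hN⟩ := (isCompact_closedBall p0 (ρ/8)).finite_cover_balls (e := τ/(3*C)) (by positivity)
  obtain ⟨j, j', hjj, hclose⟩ : ∃ j j', j < j' ∧ ∀ x ∈ N, ‖h^[j] x - h^[j'] x‖ ≤ τ/3 := by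
    have := hNf.fintype
    set u : ℕ → (N → En n) := fun j x => h^[j] x.1 with hu
    have hub : ∀ j, u j ∈ closedBall (0 : N → En n) R := by
      intro j
      rw [mem_closedBall, dist_zero_right, pi_norm_le_iff_of_nonneg T.R0]
      intro x
      exact T.bdd j _ (ball_subset_ball (by linarith) (hsub (hNs x.2)))
    obtain ⟨a, -, φ, hφ, hlim⟩ := tendsto_subseq_of_bounded (isBounded_closedBall) hub
    obtain ⟨K, hK⟩ := Metric.cauchySeq_iff'.1 hlim.cauchySeq (τ/3) (by positivity)
    refine ⟨φ K, φ (K+1), hφ (Nat.lt_succ_self K), fun x hx => ?_⟩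
    have := hK (K+1) (by simp)
    rw [dist_comm, dist_eq_norm] at this
    exact (norm_le_pi_norm (u (φ K) - u (φ (K+1))) ⟨x, hx⟩).trans this.le
  obtain ⟨m, rfl⟩ := Nat.exists_eq_add_of_le hjj.le
  have hm : 1 ≤ m := by omega
  refine ⟨m, hm, fun p hp => ?_⟩
  have hpb := hsub hp
  have hclose' : ‖h^[j] p - h^[j+m] p‖ ≤ τ := by
    obtain ⟨x, hx, hpx⟩ := mem_iUnion₂.1 (hN hp)
    rw [mem_ball, dist_eq_norm] at hpx
    have hxb := hsub (hNs hx)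
    have a1 := hlip j p hpb x hxb
    have a2 := hlip (j+m) x hxb p hpb
    rw [norm_sub_rev x p] at a2
    have a3 : C * ‖p - x‖ ≤ τ/3 := by
      calc C * ‖p - x‖ ≤ C * (τ/(3*C)) := by gcongr
        _ = τ/3 := by field_simp
    calc _ = ‖(h^[j] p - h^[j] x) + (h^[j] x - h^[j+m] x) + (h^[j+m] x - h^[j+m] p)‖ := by congr 1; abel
      _ ≤ _ := norm_add₃_le
      _ ≤ τ := by linarith [hclose x hx]
  set A := fderiv ℂ (g^[j]) (h^[j] p) with hA
  obtain ⟨hD, hA', -, hL⟩ := hC j p hpb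
  set Ψ : En n → En n := fun x => x - A (h^[j] x - h^[j+m] p) with hΨ
  have hΨd : ∀ x, HasFDerivAt Ψ (ContinuousLinearMap.id ℂ _ - A.comp (fderiv ℂ (h^[j]) x)) x := fun x =>
    (hasFDerivAt_id x).fun_sub (A.hasFDerivAt.comp x ((T.hd.iterate j x).hasFDerivAt.sub_const _))
  obtain ⟨x, hx, hfx⟩ := fp_lemma (Ψ := Ψ) (p := p) (s := s) (fun x => (hΨd x).differentiableAt) hs0.le (by
    intro x hx
    have hxb : x ∈ ball p0 (ρ/4) := by
      simp only [mem_ball, mem_closedBall] at *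
      linarith [dist_triangle x p p0]
    rw [(hΨd x).fderiv, ← T.TD j p, ← hA, ← ContinuousLinearMap.comp_sub]
    refine (ContinuousLinearMap.opNorm_comp_le _ _).trans ?_
    rw [norm_sub_rev]
    have h1 := hL x hxb
    rw [mem_closedBall, dist_eq_norm] at hx
    calc _ ≤ C * (C * (1/(2*C^2))) := by
          gcongr
          refine h1.trans ?_
          gcongr
          exact hx.trans hs1
      _ = 1/2 := by field_simp) (by
    have : Ψ p - p = - A (h^[j] p - h^[j+m] p) := by simp only [hΨ]; abel
    rw [this, norm_neg]
    refine (ContinuousLinearMap.le_opNorm _ _).trans ?_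
    calc _ ≤ C * τ := by gcongr
      _ = s/2 := by rw [hτ]; field_simp)
  have h1 : A (h^[j] x - h^[j+m] p) = 0 := by
    have : x - A (h^[j] x - h^[j+m] p) = x := hfx
    simpa using this
  have h2 : h^[j] x - h^[j+m] p = 0 := by
    have := congrArg (fun B => B (h^[j] x - h^[j+m] p)) (T.DT j p)
    simp only [ContinuousLinearMap.comp_apply, ← hA, h1, map_zero, ContinuousLinearMap.id_apply] at this
    exact this.symm
  rw [iterate_add_apply] at h2
  have h3 := T.gh.injective.iterate j (sub_eq_zero.1 h2)
  rw [← h3]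
  rw [mem_closedBall, dist_eq_norm] at hx
  exact hx.trans (min_le_left _ _)

end Trap


/-- the projection-like operator. -/
def Lop {n : ℕ} (i0 : Fin n) : En n →L[ℂ] En n :=
  (EuclideanSpace.proj i0 : En n →L[ℂ] ℂ).smulRight (EuclideanSpace.single i0 (1:ℂ))

lemma Lop_apply {n : ℕ} (i0 : Fin n) (z : En n) : Lop i0 z = z i0 • (EuclideanSpace.single i0 (1:ℂ) : En n) := by
  simp [Lop]

lemma Lop_norm {n : ℕ} (i0 : Fin n) (z : En n) : ‖Lop i0 z‖ ≤ ‖z‖ := by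
  rw [Lop_apply, norm_smul]
  simp only [PiLp.norm_single, norm_one, mul_one]
  exact PiLp.norm_apply_le z i0

def XY {n : ℕ} (i0 : Fin n) (Y : En n → En n) (z : En n) : En n :=
  Y z + fderiv ℂ Y z (Lop i0 z) - Lop i0 (Y z) - (LinearMap.trace ℂ _ (fderiv ℂ Y z : En n →ₗ[ℂ] En n)) • Lop i0 z

lemma XY_eq {n : ℕ} (i0 : Fin n) {Y : En n → En n} (hY : Differentiable ℂ Y) (z : En n) :
    ∑ i, XH i0 i (fun z => z i0 * Y z i) z = XY i0 Y z := by
  have hd : ∀ i u, fderiv ℂ (fun z => z i0 * Y z i) z u = u i0 * Y z i + z i0 * (fderiv ℂ Y z u) i := by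
    intro i u
    have h1 : HasFDerivAt (fun z : En n => z i0) (EuclideanSpace.proj i0 : En n →L[ℂ] ℂ) z :=
      (EuclideanSpace.proj i0 : En n →L[ℂ] ℂ).hasFDerivAt
    have h2 : HasFDerivAt (fun z : En n => Y z i) ((EuclideanSpace.proj i : En n →L[ℂ] ℂ).comp (fderiv ℂ Y z)) z :=
      (EuclideanSpace.proj i : En n →L[ℂ] ℂ).hasFDerivAt.comp z (hY z).hasFDerivAt
    have h3 := (h1.mul h2).fderiv
    have h4 : ((fun z : En n => z i0) * fun z => Y z i) = fun z => z i0 * Y z i := rfl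
    rw [h4] at h3
    rw [h3]
    simp; ring
  have htr : LinearMap.trace ℂ _ (fderiv ℂ Y z : En n →ₗ[ℂ] En n) = ∑ i, (fderiv ℂ Y z (EuclideanSpace.single i 1)) i := by
    rw [LinearMap.trace_eq_matrix_trace ℂ (EuclideanSpace.basisFun (Fin n) ℂ).toBasis, Matrix.trace]
    refine Finset.sum_congr rfl fun i _ => ?_
    simp [LinearMap.toMatrix_apply]
  set D := fderiv ℂ Y z with hD
  simp only [XH, hd]
  rw [Finset.sum_sub_distrib]
  have a1 : ∑ x, (((EuclideanSpace.single i0 (1:ℂ) : En n) i0 * Y z x + z i0 * (D (EuclideanSpace.single i0 1)) x) • (EuclideanSpace.single x (1:ℂ) : En n)) = Y z + D (Lop i0 z) := by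
    have : Y z + D (Lop i0 z) = Y z + z i0 • D (EuclideanSpace.single i0 1) := by rw [Lop_apply, map_smul]
    rw [this, en_sum_coord (Y z + z i0 • D (EuclideanSpace.single i0 1))]
    refine Finset.sum_congr rfl fun x _ => ?_
    simp
  have a2 : ∑ x, (((EuclideanSpace.single x (1:ℂ) : En n) i0 * Y z x + z i0 * (D (EuclideanSpace.single x 1)) x) • (EuclideanSpace.single i0 (1:ℂ) : En n)) = Lop i0 (Y z) + (∑ i, (D (EuclideanSpace.single i 1)) i) • Lop i0 z := by
    rw [← Finset.sum_smul, Finset.sum_add_distrib, add_smul, Lop_apply, Lop_apply]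
    congr 1
    · congr 1
      simp
    · rw [smul_smul, ← Finset.mul_sum, mul_comm]
  rw [a1, a2, XY, htr]
  abel

lemma tele {E : Type*} [NormedAddCommGroup E] (c : ℕ → E) {B : ℝ} (hB : ∀ j, ‖c j‖ ≤ B) (k m : ℕ) :
    ‖∑ j ∈ Finset.range k, (c j - c (j+m))‖ ≤ 2 * m * B := by
  induction m with
  | zero => simp
  | succ m ih =>
    have h1 : ∑ j ∈ Finset.range k, (c (j+m) - c (j+1+m)) = c m - c (k+m) := by
      have := Finset.sum_range_sub' (fun j => c (j+m)) k
      simpa using this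
    have h2 : ∑ j ∈ Finset.range k, (c j - c (j+(m+1))) = ∑ j ∈ Finset.range k, (c j - c (j+m)) + (c m - c (k+m)) := by
      rw [← h1, ← Finset.sum_add_distrib]
      refine Finset.sum_congr rfl fun j _ => ?_
      rw [show j + (m+1) = j + 1 + m by ring]; abel
    rw [h2]
    refine (norm_add_le _ _).trans ?_
    have := norm_sub_le (c m) (c (k+m))
    push_cast
    linarith [hB m, hB (k+m)]

namespace Trap
variable {n : ℕ} {h g : En n → En n} {p0 : En n} {ρ R : ℝ}

set_option maxHeartbeats 2000000 in
lemma key_est (T : Trap h g p0 ρ R) (i0 : Fin n) : ∃ K > 0, ∃ ε0 > 0, ∀ m : ℕ, ∀ p ∈ ball p0 (ρ/4), h^[m] p ∈ ball p0 (ρ/4) → ∀ ε1 : ℝ, ε1 ≤ ε0 →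
    ‖h^[m] p - p‖ + ‖fderiv ℂ (fun z => h^[m] z - z) p‖ ≤ ε1 → ‖h^[m] p - p‖ ≤ K * ε1^2 := by
  obtain ⟨C, hC1, hC⟩ := T.consts
  obtain ⟨Ct, hCt0, hCt⟩ := trace_bound n
  have hρ := T.pos
  have hR := T.R0
  refine ⟨C^2 + Ct * C^7 * R + C^7*R + 2*C^5, by positivity, min 1 (1/(2*C^3)), by positivity, ?_⟩
  set K := C^2 + Ct * C^7 * R + C^7*R + 2*C^5 with hK
  intro m p hp hFp ε1 hε1 hle
  set Y : En n → En n := fun z => h^[m] z - z with hY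
  have hYd : Differentiable ℂ Y := (T.hd.iterate m).sub differentiable_id
  have hDY : ∀ z, fderiv ℂ Y z = fderiv ℂ (h^[m]) z - ContinuousLinearMap.id ℂ _ := fun z =>
    ((T.hd.iterate m z).hasFDerivAt.sub (hasFDerivAt_id z)).fderiv
  have hgood : GoodX h g p0 ρ (XY i0 Y) := by
    have : XY i0 Y = fun z => ∑ i, XH i0 i (fun z => z i0 * Y z i) z := by
      funext z; rw [XY_eq i0 hYd]
    rw [this]
    refine GoodX.sum _ fun i _ => (T.good_all i0 ?_).2 i
    have h1 : Differentiable ℂ (fun z : En n => z i0) := (EuclideanSpace.proj i0 : En n →L[ℂ] ℂ).differentiable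
    have h2 : Differentiable ℂ (fun z : En n => Y z i) := (EuclideanSpace.proj i : En n →L[ℂ] ℂ).differentiable.comp hYd
    exact h1.mul h2
  set a := ‖h^[m] p - p‖ with ha
  have ha0 : 0 ≤ a := norm_nonneg _
  set d := ‖fderiv ℂ Y p‖ with hd
  have hd0 : 0 ≤ d := norm_nonneg _
  have ha1 : a ≤ ε1 := by linarith
  have hε10 : 0 ≤ ε1 := by linarith
  have hε11 : ε1 ≤ 1 := hε1.trans (min_le_left _ _)
  have hε12 : ε1 ≤ 1/(2*C^3) := hε1.trans (min_le_right _ _)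
  set c : ℕ → En n := fun j => fderiv ℂ (g^[j+1]) (h^[j+1] p) (Lop i0 (h^[j+1] p)) with hc
  have hpρ : p ∈ ball p0 ρ := ball_subset_ball (by linarith) hp
  have hcB : ∀ j, ‖c j‖ ≤ C * R := fun j => by
    refine (ContinuousLinearMap.le_opNorm _ _).trans ?_
    gcongr
    · exact (hC (j+1) p hp).2.1
    · exact (Lop_norm _ _).trans (T.bdd _ _ hpρ)
  have hterm : ∀ j, ‖fderiv ℂ (g^[j+1]) (h^[j+1] p) (XY i0 Y (h^[j+1] p)) - Y p - (c j - c (j+m))‖ ≤ K * ε1^2 := by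
    intro j
    obtain ⟨hD, hT, hTay, hL⟩ := hC (j+1) p hp
    have hT' := (hC (j+1+m) p hp).2.1
    have hTadd := T.T_add (j+1) m p
    have hxb : ‖h^[j+1] p‖ ≤ R := T.bdd _ _ hpρ
    set x := h^[j+1] p with hx
    set A := fderiv ℂ (g^[j+1]) x with hA
    set A' := fderiv ℂ (g^[j+1+m]) (h^[j+1+m] p) with hA'
    set D := fderiv ℂ (h^[j+1]) p with hDdef
    set Ej := fderiv ℂ Y x with hEj
    have hAA : ∀ u, A u = A' u + A' (Ej u) := by
      intro u
      rw [← hTadd, hEj, hDY]; simp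
    have hYx : Y x = h^[j+1] (h^[m] p) - h^[j+1] p := by
      simp only [hY, hx]
      rw [← iterate_add_apply, ← iterate_add_apply, add_comm]
    have hcj : c (j+m) = A' (Lop i0 x) + A' (Lop i0 (Y x)) := by
      have e1 : h^[j+1+m] p = x + Y x := by
        simp only [hY, hx]; rw [← iterate_add_apply, add_comm m]; abel
      have e2 : c (j+m) = A' (Lop i0 (h^[j+1+m] p)) := by
        simp only [hc, hA']
        rw [show j + m + 1 = j + 1 + m by ring]
      rw [e2, e1, map_add, map_add]
    have hFm : ‖fderiv ℂ (h^[m]) p‖ ≤ C := (hC m p hp).1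
    have htay := hTay _ hFp
    have hAD : ∀ u, A (D u) = u := fun u => by
      have := congrArg (fun B => B u) (T.TD (j+1) p)
      exact this
    have hr1 : ‖A (Y x) - Y p‖ ≤ C^2 * a^2 := by
      have : A (Y x) - Y p = A (h^[j+1] (h^[m] p) - h^[j+1] p - D (h^[m] p - p)) := by
        rw [map_sub A _ (D _), hAD, hYx]
      rw [this]
      refine (ContinuousLinearMap.le_opNorm _ _).trans ?_
      calc _ ≤ C * (C * a^2) := by gcongr
        _ = _ := by ring
    have hYn : ‖Y x‖ ≤ 2 * C * a := by
      have : Y x = (h^[j+1] (h^[m] p) - h^[j+1] p - D (h^[m] p - p)) + D (h^[m] p - p) := by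
        rw [hYx]; abel
      rw [this]
      refine (norm_add_le _ _).trans ?_
      have h2 : ‖D (h^[m] p - p)‖ ≤ C * a := (ContinuousLinearMap.le_opNorm _ _).trans (by gcongr)
      have h3 : C * a^2 ≤ C * a := by gcongr; nlinarith
      linarith
    have hEn : ‖Ej‖ ≤ C^3 * ε1 := by
      have e1 : Ej = ((fderiv ℂ (h^[j+1]) (h^[m] p) - D).comp (fderiv ℂ (h^[m]) p) + D.comp (fderiv ℂ Y p)).comp A := by
        have f1 := fderiv_iter_add T.hd m (j+1) p
        have f2 := fderiv_iter_add T.hd (j+1) m p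
        rw [add_comm m, f2] at f1
        have f3 := T.DT (j+1) p
        rw [hDY p, ContinuousLinearMap.sub_comp, ContinuousLinearMap.comp_sub, f1, ContinuousLinearMap.comp_id,
          sub_add_sub_cancel, ContinuousLinearMap.sub_comp, ContinuousLinearMap.comp_assoc, f3, hEj, hDY]
        simp [hx]
      rw [e1]
      refine (ContinuousLinearMap.opNorm_comp_le _ _).trans ?_
      have f1 : ‖(fderiv ℂ (h^[j+1]) (h^[m] p) - D).comp (fderiv ℂ (h^[m]) p)‖ ≤ C * a * C :=
        (ContinuousLinearMap.opNorm_comp_le _ _).trans (by gcongr; exact hL _ hFp)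
      have f2 : ‖D.comp (fderiv ℂ Y p)‖ ≤ C * d :=
        (ContinuousLinearMap.opNorm_comp_le _ _).trans (by gcongr)
      have f3 : C * a * C + C * d ≤ C^2 * ε1 := by
        have : C * d ≤ C^2 * d := by gcongr; nlinarith
        nlinarith
      calc _ ≤ (C^2 * ε1) * C := by
            gcongr
            exact (norm_add_le _ _).trans ((add_le_add f1 f2).trans f3)
        _ = _ := by ring
    have hEn1 : ‖Ej‖ < 1 := by
      refine hEn.trans_lt ?_
      calc C^3 * ε1 ≤ C^3 * (1/(2*C^3)) := by gcongr
        _ = 1/2 := by field_simp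
        _ < 1 := by norm_num
    have htr := hCt Ej (by
      rw [hEj, hDY, add_sub_cancel]
      exact det_iter T.hd T.vol m x) hEn1
    set tr := LinearMap.trace ℂ _ (Ej : En n →ₗ[ℂ] En n) with htrd
    have hid : A (XY i0 Y x) - Y p - (c j - c (j+m)) = (A (Y x) - Y p) - tr • A (Lop i0 x)
        + A' (Ej (Ej (Lop i0 x)) - Ej (Lop i0 (Y x))) := by
      have e1 : A (XY i0 Y x) = A (Y x) + A (Ej (Lop i0 x) - Lop i0 (Y x)) - tr • A (Lop i0 x) := by
        rw [XY, map_sub, map_smul, ← hEj, ← htrd, add_sub_assoc, map_add]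
      have e2 : c j = A (Lop i0 x) := rfl
      rw [e1, hcj, e2, hAA (Ej (Lop i0 x) - Lop i0 (Y x)), hAA (Lop i0 x)]
      simp only [map_sub]
      abel
    rw [hid]
    have hLx : ‖Lop i0 x‖ ≤ R := (Lop_norm _ _).trans hxb
    have hLY : ‖Lop i0 (Y x)‖ ≤ 2 * C * a := (Lop_norm _ _).trans hYn
    have hr2 : ‖tr • A (Lop i0 x)‖ ≤ Ct * (C^3 * ε1)^2 * (C * R) := by
      rw [norm_smul]
      gcongr
      · refine htr.trans ?_
        gcongr
      · exact (ContinuousLinearMap.le_opNorm _ _).trans (by gcongr)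
    have hr3 : ‖A' (Ej (Ej (Lop i0 x)) - Ej (Lop i0 (Y x)))‖ ≤ C * ((C^3*ε1) * ((C^3*ε1)*R) + (C^3*ε1)*(2*C*a)) := by
      refine (ContinuousLinearMap.le_opNorm _ _).trans ?_
      gcongr
      refine (norm_sub_le _ _).trans ?_
      gcongr
      · refine (ContinuousLinearMap.le_opNorm _ _).trans ?_
        gcongr
        exact (ContinuousLinearMap.le_opNorm _ _).trans (by gcongr)
      · exact (ContinuousLinearMap.le_opNorm _ _).trans (by gcongr)
    calc _ ≤ C^2 * a^2 + Ct * (C^3 * ε1)^2 * (C * R) + C * ((C^3*ε1) * ((C^3*ε1)*R) + (C^3*ε1)*(2*C*a)) := by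
          refine (norm_add_le _ _).trans (add_le_add ?_ hr3)
          exact (norm_sub_le _ _).trans (add_le_add hr1 hr2)
      _ ≤ C^2 * ε1^2 + Ct * (C^3 * ε1)^2 * (C * R) + C * ((C^3*ε1) * ((C^3*ε1)*R) + (C^3*ε1)*(2*C*ε1)) := by gcongr
      _ = K * ε1^2 := by rw [hK]; ring
  have hsum : ∀ k : ℕ, k * a ≤ ‖bsum h g (XY i0 Y) p k‖ + k * (K * ε1^2) + 2 * m * (C * R) := by
    intro k
    have e1 : ∑ j ∈ Finset.range k, (fderiv ℂ (g^[j+1]) (h^[j+1] p) (XY i0 Y (h^[j+1] p)) - Y p - (c j - c (j+m)))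
        = bsum h g (XY i0 Y) p k - (k:ℂ) • Y p - ∑ j ∈ Finset.range k, (c j - c (j+m)) := by
      rw [Finset.sum_sub_distrib, Finset.sum_sub_distrib, bsum, Finset.sum_const, Finset.card_range, Nat.cast_smul_eq_nsmul]
    have e2 : ‖∑ j ∈ Finset.range k, (fderiv ℂ (g^[j+1]) (h^[j+1] p) (XY i0 Y (h^[j+1] p)) - Y p - (c j - c (j+m)))‖ ≤ k * (K * ε1^2) := by
      refine (norm_sum_le_of_le _ fun j _ => hterm j).trans ?_
      simp
    have e3 := tele c hcB k m
    rw [e1] at e2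
    have e4 : (k:ℂ) • Y p = bsum h g (XY i0 Y) p k - (bsum h g (XY i0 Y) p k - (k:ℂ) • Y p - ∑ j ∈ Finset.range k, (c j - c (j+m))) - ∑ j ∈ Finset.range k, (c j - c (j+m)) := by abel
    have e5 : ‖(k:ℂ) • Y p‖ = k * a := by rw [norm_smul]; simp [ha, hY]
    rw [← e5, e4]
    refine (norm_sub_le _ _).trans ?_
    have := norm_sub_le (bsum h g (XY i0 Y) p k) (bsum h g (XY i0 Y) p k - (k:ℂ) • Y p - ∑ j ∈ Finset.range k, (c j - c (j+m)))
    linarith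
  refine le_of_forall_pos_le_add fun ε hε => ?_
  have hat : Tendsto (fun k : ℕ => ε/2 * (k:ℝ)) atTop atTop := tendsto_natCast_atTop_atTop.const_mul_atTop (by linarith)
  obtain ⟨k, h1, h2, h3⟩ := ((hgood p hp (ε/2) (by linarith)).and ((hat.eventually_ge_atTop (2 * m * (C * R))).and (eventually_gt_atTop 0))).exists
  have h4 := hsum k
  have hk : (0:ℝ) < k := by exact_mod_cast h3
  have h5 : k * a ≤ k * (K * ε1^2 + ε) := by nlinarith
  exact le_of_mul_le_mul_left h5 hk

end Trap


namespace Trap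
variable {n : ℕ} {h g : En n → En n} {p0 : En n} {ρ R : ℝ}

lemma periodic (T : Trap h g p0 ρ R) (i0 : Fin n) : ∃ m ≥ 1, h^[m] = id := by
  obtain ⟨K, hK, ε0, hε0, hkey⟩ := T.key_est i0
  have hρ := T.pos
  set r : ℝ := ρ/8/Real.exp 4 with hr
  have hr0 : 0 < r := by positivity
  have hre : r * Real.exp 4 = ρ/8 := by rw [hr]; field_simp
  have hrρ : r ≤ ρ/8 := by
    rw [← hre]; exact le_mul_of_one_le_right hr0.le (Real.one_le_exp (by norm_num))
  set B : ℝ := 1 + 2/r with hB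
  have hB0 : 0 < B := by positivity
  set θ0 : ℝ := min 1 (min (ε0/B) (1/(2*K*B^2))) with hθ0
  have hθ0p : 0 < θ0 := by positivity
  obtain ⟨m, hm, hrec⟩ := T.recur (η := min (θ0^4) (ρ/16)) (by positivity)
  refine ⟨m, hm, ?_⟩
  have hYd : Differentiable ℂ (fun z => h^[m] z - z) := (T.hd.iterate m).sub differentiable_id
  obtain ⟨p, hp, hmax⟩ := (isCompact_closedBall p0 r).exists_isMaxOn ⟨p0, mem_closedBall_self hr0.le⟩ hYd.continuous.norm.continuousOn
  have hmax' : ∀ z ∈ closedBall p0 r, ‖h^[m] z - z‖ ≤ ‖h^[m] p - p‖ := fun z hz => hmax hz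
  set a := ‖h^[m] p - p‖ with ha
  have ha0 : 0 ≤ a := norm_nonneg _
  rcases ha0.eq_or_lt with h0 | hapos
  · refine cx_identity (T.hd.iterate m) differentiable_id hr0 (c := p0) fun z hz => ?_
    have := hmax' z (ball_subset_closedBall hz)
    rw [← h0] at this
    exact sub_eq_zero.1 (norm_le_zero_iff.1 this)
  exfalso
  have hrec' := fun z (hz : z ∈ closedBall p0 (ρ/8)) => (hrec z hz).trans (min_le_left _ _)
  have hpb : p ∈ closedBall p0 (ρ/8) := closedBall_subset_closedBall hrρ hp
  have haη : a ≤ θ0^4 := hrec' p hpb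
  have haρ : a ≤ ρ/16 := (hrec p hpb).trans (min_le_right _ _)
  have hθ01 : θ0 ≤ 1 := min_le_left _ _
  have hη1 : θ0^4 ≤ 1 := pow_le_one₀ hθ0p.le hθ01
  set θ : ℝ := a ^ (1/4 : ℝ) with hθ
  have hθpos : 0 < θ := by positivity
  have hθ4 : θ^4 = a := by
    rw [hθ, ← Real.rpow_natCast, ← Real.rpow_mul ha0]; norm_num
  have hθ3 : a^(3/4:ℝ) = θ^3 := by
    rw [hθ, ← Real.rpow_natCast, ← Real.rpow_mul ha0]; norm_num
  have hθle : θ ≤ θ0 := by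
    rw [← hθ4] at haη
    exact (pow_le_pow_iff_left₀ hθpos.le hθ0p.le (by norm_num)).1 haη
  have h3 := cx_three hYd hr0 hapos (haη.trans hη1) hmax' (by
    rw [hre]; intro z hz; exact (hrec' z hz).trans hη1)
  rw [Real.one_rpow, mul_one, hθ3] at h3
  have he : 2 ≤ Real.exp 1 := by linarith [Real.add_one_le_exp (1:ℝ)]
  have hDY := cx_cauchy hYd (c := p) (r := r) (M := θ^3) hr0 (fun z hz => h3 z (by
    simp only [mem_ball, mem_closedBall] at *
    nlinarith [dist_triangle z p p0]))
  have hθ1 : θ ≤ 1 := hθle.trans hθ01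
  have h4 : a + ‖fderiv ℂ (fun z => h^[m] z - z) p‖ ≤ B * θ^3 := by
    have : a ≤ θ^3 := by
      rw [← hθ4]; exact pow_le_pow_of_le_one hθpos.le hθ1 (by norm_num)
    calc _ ≤ θ^3 + 2 * θ^3/r := by gcongr
      _ = _ := by rw [hB]; ring
  have h5 := hkey m p (closedBall_subset_ball (by linarith) hpb) (by
    simp only [mem_ball, mem_closedBall] at *
    have := dist_triangle (h^[m] p) p p0
    rw [dist_eq_norm (h^[m] p) p] at this
    linarith) (B * θ^3) (by
      have h6 : θ ≤ ε0/B := hθle.trans ((min_le_right _ _).trans (min_le_left _ _))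
      have h7 : θ^3 ≤ θ := by
        simpa using pow_le_pow_of_le_one hθpos.le hθ1 (by norm_num : 1 ≤ 3)
      calc B * θ^3 ≤ B * (ε0/B) := by gcongr; linarith
        _ = ε0 := by field_simp) h4
  rw [← ha, ← hθ4] at h5
  have h6 : θ ≤ 1/(2*K*B^2) := hθle.trans ((min_le_right _ _).trans (min_le_right _ _))
  have h7 : K * B^2 * θ ≤ 1/2 := by
    calc K * B^2 * θ ≤ K * B^2 * (1/(2*K*B^2)) := by gcongr
      _ = 1/2 := by field_simp
  have h8 : K * (B*θ^3)^2 = (K * B^2 * θ) * θ * θ^4 := by ring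
  rw [h8] at h5
  have h9 : 0 < θ^4 := by positivity
  have h10 : (K * B^2 * θ) * θ ≤ 1/2 := by nlinarith
  nlinarith

end Trap

lemma dense_inner_ne {n : ℕ} {u : En n} (hu : u ≠ 0) : Dense {w : En n | inner ℂ w u ≠ 0} := by
  intro w
  by_cases hw : inner ℂ w u = 0
  · refine mem_closure_of_tendsto (f := fun t : ℂ => w + t • u) (b := 𝓝[≠] 0) ?_ ?_
    · have : Continuous fun t : ℂ => w + t • u := by fun_prop
      have := (this.tendsto 0).mono_left (nhdsWithin_le_nhds (s := {0}ᶜ))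
      simpa using this
    · filter_upwards [self_mem_nhdsWithin] with t ht
      have ht' : t ≠ 0 := ht
      simp [inner_add_left, hw, inner_smul_left, ht', hu]
  · exact subset_closure hw

lemma isOpen_inner_ne {n : ℕ} (u : En n) : IsOpen {w : En n | inner ℂ w u ≠ 0} :=
  isOpen_ne_fun (by fun_prop) continuous_const

lemma gen_dense {n : ℕ} (S : Set (En n)) (hS : S.Finite) (h0 : ∀ u ∈ S, u ≠ 0) :
    Dense {w : En n | ∀ u ∈ S, inner ℂ w u ≠ 0} := by
  have := dense_biInter_of_isOpen (S := S) (f := fun u => {w : En n | inner ℂ w u ≠ 0}) (fun u _ => isOpen_inner_ne u)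
    hS.countable (fun u hu => dense_inner_ne (h0 u hu))
  convert this using 1
  ext w; simp

lemma exists_ker {n : ℕ} (hn : 2 ≤ n) (l : En n →L[ℂ] ℂ) : ∃ v ≠ 0, l v = 0 := by
  by_contra! hc
  have : Injective (l : En n →ₗ[ℂ] ℂ) := by
    rw [← LinearMap.ker_eq_bot, LinearMap.ker_eq_bot']
    intro m hm
    by_contra hm0
    exact hc m hm0 hm
  have := LinearMap.finrank_le_finrank_of_injective this
  simp at this
  omega

/-- Interpolating polynomial. -/
def ipoly (s : Finset ℂ) (ζ0 : ℂ) (ζ : ℂ) : ℂ := ∏ τ ∈ s, (ζ - τ) / (ζ0 - τ)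

lemma ipoly_diff (s : Finset ℂ) (ζ0 : ℂ) : Differentiable ℂ (ipoly s ζ0) := by
  unfold ipoly; fun_prop

lemma ipoly_self {s : Finset ℂ} {ζ0 : ℂ} (h : ζ0 ∉ s) : ipoly s ζ0 ζ0 = 1 := by
  refine Finset.prod_eq_one fun τ hτ => div_self ?_
  rw [sub_ne_zero]; rintro rfl; exact h hτ

lemma ipoly_mem {s : Finset ℂ} {ζ0 ζ : ℂ} (h : ζ ∈ s) : ipoly s ζ0 ζ = 0 :=
  Finset.prod_eq_zero h (by simp)

namespace Trap
variable {n : ℕ} {h g : En n → En n} {p0 : En n} {ρ R : ℝ}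

lemma false (T : Trap h g p0 ρ R) (hn : 2 ≤ n) : False := by
  classical
  have hex := T.periodic ⟨0, by omega⟩
  set m := Nat.find hex with hm
  obtain ⟨hm1, hid⟩ := Nat.find_spec hex
  have hmin : ∀ j, 0 < j → j < m → h^[j] ≠ id := fun j hj hjm he => Nat.find_min hex hjm ⟨hj, he⟩
  have hρ := T.pos
  have hdense : Dense (⋂ j ∈ Ioo 0 m, {p : En n | h^[j] p ≠ p}) := by
    refine dense_biInter_of_isOpen (fun j _ => isOpen_ne_fun (T.hd.iterate j).continuous continuous_id) (to_countable _) fun j hj => ?_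
    intro x
    rw [Metric.mem_closure_iff]
    intro ε hε
    by_contra! hc
    refine hmin j hj.1 hj.2 (cx_identity (T.hd.iterate j) differentiable_id hε (c := x) fun z hz => ?_)
    by_contra hz2
    have := hc z hz2
    rw [mem_ball, dist_comm] at hz
    linarith
  obtain ⟨p, hpb, hp⟩ := hdense.inter_open_nonempty (ball p0 (ρ/4)) isOpen_ball ⟨p0, mem_ball_self (by linarith)⟩
  have hp' : ∀ j, 0 < j → j < m → h^[j] p ≠ p := fun j h1 h2 => by
    simp only [mem_iInter] at hp
    exact hp j ⟨h1, h2⟩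
  obtain ⟨w, hw⟩ := (gen_dense ((fun j => h^[j] p - p) '' Ioo 0 m) ((finite_Ioo 0 m).image _) (by
    rintro _ ⟨j, hj, rfl⟩
    exact sub_ne_zero.2 (hp' j hj.1 hj.2))).nonempty
  set l : En n →L[ℂ] ℂ := innerSL ℂ w with hl
  have hl' : ∀ j, 0 < j → j < m → l p ≠ l (h^[j] p) := fun j h1 h2 he => by
    refine hw _ ⟨j, ⟨h1, h2⟩, rfl⟩ ?_
    change l (h^[j] p - p) = 0
    rw [map_sub, he, sub_self]
  obtain ⟨v, hv0, hv⟩ := exists_ker hn l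
  set s : Finset ℂ := (Finset.Ioo 0 m).image (fun j => l (h^[j] p)) with hs
  have hnot : l p ∉ s := by
    rw [hs, Finset.mem_image]
    rintro ⟨j, hj, he⟩
    rw [Finset.mem_Ioo] at hj
    exact hl' j hj.1 hj.2 he.symm
  obtain ⟨B, hB⟩ := T.shear_bdd (ipoly s (l p)) l v (ipoly_diff _ _) hv
  have hmod : ∀ j, h^[j] p = h^[j % m] p := by
    intro j
    conv_lhs => rw [← Nat.mod_add_div j m, iterate_add_apply, iterate_mul, hid, iterate_id, id]
  have hmodg : ∀ q : ℕ, g^[m*q] = id := by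
    intro q
    have : h^[m*q] = id := by rw [iterate_mul, hid, iterate_id]
    funext x
    have h1 := T.gh.iterate (m*q) x
    rw [this] at h1
    exact h1
  have hterm : ∀ j, fderiv ℂ (g^[j]) (h^[j] p) (ipoly s (l p) (l (h^[j] p)) • v) = if m ∣ j then v else 0 := by
    intro j
    split_ifs with hd
    · have : h^[j] p = p := by rw [hmod, Nat.mod_eq_zero_of_dvd hd, iterate_zero, id]
      rw [this, ipoly_self hnot]
      obtain ⟨q, rfl⟩ := hd
      rw [hmodg, fderiv_id]; simp
    · rw [ipoly_mem]
      · simp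
      · rw [hs, Finset.mem_image]
        refine ⟨j % m, ?_, by rw [← hmod]⟩
        rw [Finset.mem_Ioo]
        refine ⟨Nat.pos_of_ne_zero fun h => hd (Nat.dvd_of_mod_eq_zero h), Nat.mod_lt _ (by omega)⟩
  have hbs : ∀ q : ℕ, bsum h g (fun z => ipoly s (l p) (l z) • v) p (m*q) = (q:ℂ) • v := by
    intro q
    simp only [bsum, hterm]
    rw [← Finset.sum_filter, Finset.sum_const, Nat.cast_smul_eq_nsmul]
    congr 1
    have : (Finset.filter (fun j => m ∣ j + 1) (Finset.range (m*q))).card = (m*q)/m := by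
      rw [← Nat.count_eq_card_filter_range, ← Nat.card_multiples]
      rw [Nat.count_eq_card_filter_range]
    rw [this, Nat.mul_div_cancel_left _ (by omega)]
  obtain ⟨q, hq⟩ := exists_nat_gt (B/‖v‖)
  have h1 := hB p hpb (m*q)
  rw [hbs, norm_smul] at h1
  rw [div_lt_iff₀ (norm_pos_iff.2 hv0)] at hq
  simp at h1
  linarith

end Trap

lemma escape {n : ℕ} (hn : 2 ≤ n) {h g : En n → En n} (hd : Differentiable ℂ h) (gd : Differentiable ℂ g) (gh : LeftInverse g h)
    (hg : RightInverse g h) (vol : ∀ z, (fderiv ℂ h z).det = 1) {U : Set (En n)} (hU : IsOpen U) (hne : U.Nonempty) (R : ℝ) :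
    ∃ (φ : ℂ → ℂ) (l : En n →L[ℂ] ℂ) (v : En n), Differentiable ℂ φ ∧ l v = 0 ∧ ∀ δ > 0, ∃ t : ℂ, ‖t‖ < δ ∧
      ∃ p ∈ U, ∃ k : ℕ, R < ‖(fun z => h z + (t * φ (l (h z))) • v)^[k] p‖ := by
  by_contra! hc
  obtain ⟨p0, hp0⟩ := hne
  obtain ⟨ρ, hρ, hsub⟩ := Metric.isOpen_iff.1 hU p0 hp0
  have T : Trap h g p0 ρ R := ⟨hd, gd, gh, hg, vol, hρ, fun φ l v hφ hl => by
    obtain ⟨δ, hδ, hh⟩ := hc φ l v hφ hl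
    exact ⟨δ, hδ, fun t ht p hp k => hh t ht p (hsub hp) k⟩⟩
  exact T.false hn


def IsA {n : ℕ} (f : En n → En n) : Prop := IsHoloAut f ∧ IsVolPres f

def Near {n : ℕ} (f g : En n → En n) (R ε : ℝ) : Prop := ∀ z, ‖z‖ ≤ R → ‖g z - f z‖ ≤ ε

lemma Near.mono {n : ℕ} {f g : En n → En n} {R R' ε ε' : ℝ} (h : Near f g R ε) (hR : R' ≤ R) (hε : ε ≤ ε') : Near f g R' ε' :=
  fun z hz => (h z (hz.trans hR)).trans hε

lemma Near.trans {n : ℕ} {f g k : En n → En n} {R ε ε' : ℝ} (h : Near f g R ε) (h' : Near g k R ε') : Near f k R (ε + ε') := fun z hz => by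
  have : k z - f z = (k z - g z) + (g z - f z) := by abel
  rw [this]
  refine (norm_add_le _ _).trans ?_
  linarith [h z hz, h' z hz]

def OpenP {n : ℕ} (P : (En n → En n) → Prop) : Prop := ∀ f, IsA f → P f → ∃ R, ∃ ε > 0, ∀ g, IsA g → Near f g R ε → P g
def DenseP {n : ℕ} (P : (En n → En n) → Prop) : Prop := ∀ f, IsA f → ∀ R, ∀ ε > 0, ∃ g, IsA g ∧ Near f g R ε ∧ P g

lemma nhds_aut {n : ℕ} (f : ↥(AutOmega n)) : (𝓝 f).HasBasis (fun p : Set (En n) × ℝ => IsCompact p.1 ∧ 0 < p.2)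
    (fun p => {g | ∀ x ∈ p.1, dist (f.1 x) (g.1 x) ≤ p.2}) := by
  have hb := nhds_basis_uniformity' ((Metric.uniformity_basis_dist_le (α := En n)).compactConvergenceUniformity (α := En n)) (x := f.1)
  rw [nhds_subtype_eq_comap]
  exact hb.comap _

lemma isOpen_of_openP {n : ℕ} {P : (En n → En n) → Prop} (h : OpenP P) : IsOpen {f : ↥(AutOmega n) | P ⇑f.1} := by
  rw [isOpen_iff_mem_nhds]
  intro f hf
  obtain ⟨R, ε, hε, hh⟩ := h f.1 f.2 hf
  rw [(nhds_aut f).mem_iff]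
  refine ⟨(closedBall 0 R, ε), ⟨isCompact_closedBall 0 R, hε⟩, fun g hg => hh g.1 g.2 fun z hz => ?_⟩
  have := hg z (by simpa using hz)
  rwa [dist_comm, dist_eq_norm] at this

lemma dense_of_denseP {n : ℕ} {P : (En n → En n) → Prop} (h : DenseP P) : Dense {f : ↥(AutOmega n) | P ⇑f.1} := by
  intro f
  rw [mem_closure_iff_nhds_basis (nhds_aut f)]
  rintro ⟨K, ε⟩ ⟨hK, hε⟩
  obtain ⟨R, hR⟩ := hK.isBounded.subset_closedBall 0
  obtain ⟨g, hgA, hg, hP⟩ := h f.1 f.2 R ε hε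
  refine ⟨⟨⟨g, hgA.1.1.continuous⟩, hgA⟩, hP, fun x hx => ?_⟩
  rw [dist_comm, dist_eq_norm]
  exact hg x (by simpa using hR hx)

lemma isA_id {n : ℕ} : IsA (id : En n → En n) :=
  ⟨⟨differentiable_id, id, differentiable_id, fun _ => rfl, fun _ => rfl⟩, fun z => by
    rw [fderiv_id]; exact LinearMap.det_id⟩

lemma IsA.comp {n : ℕ} {f k : En n → En n} (hf : IsA f) (hk : IsA k) : IsA (f ∘ k) := by
  obtain ⟨⟨fd, f', fd', h1, h2⟩, fv⟩ := hf
  obtain ⟨⟨kd, k', kd', h3, h4⟩, kv⟩ := hk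
  refine ⟨⟨fd.comp kd, k' ∘ f', kd'.comp fd', h1.comp h3, h2.comp h4⟩, fun z => ?_⟩
  rw [fderiv_comp z (fd _) (kd _)]
  have := LinearMap.det_comp (fderiv ℂ f (k z) : En n →ₗ[ℂ] En n) (fderiv ℂ k z : En n →ₗ[ℂ] En n)
  refine this.trans ?_
  have a1 := fv (k z)
  have a2 := kv z
  simp only [ContinuousLinearMap.det] at a1 a2
  rw [a1, a2, one_mul]

lemma shear_fderiv {n : ℕ} {φ : ℂ → ℂ} (hφ : Differentiable ℂ φ) (l : En n →L[ℂ] ℂ) (v : En n) (z : En n) :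
    HasFDerivAt (fun z => z + φ (l z) • v) (ContinuousLinearMap.id ℂ _ + (deriv φ (l z) • l).smulRight v) z := by
  have h1 : HasFDerivAt (fun z => φ (l z)) (deriv φ (l z) • l) z := (hφ (l z)).hasDerivAt.comp_hasFDerivAt z l.hasFDerivAt
  exact (hasFDerivAt_id z).fun_add (h1.smul_const v)

lemma isA_shear {n : ℕ} {φ : ℂ → ℂ} (hφ : Differentiable ℂ φ) {l : En n →L[ℂ] ℂ} {v : En n} (hl : l v = 0) :
    IsA (fun z => z + φ (l z) • v) := by
  refine ⟨⟨fun z => (shear_fderiv hφ l v z).differentiableAt, fun z => z + (- φ (l z)) • v,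
    fun z => (shear_fderiv hφ.neg l v z).differentiableAt, fun z => ?_, fun z => ?_⟩, fun z => ?_⟩
  · simp [hl]
  · simp [hl]
  · rw [(shear_fderiv hφ l v z).fderiv]
    have := LinearMap.transvection.det ((deriv φ (l z) • l : En n →L[ℂ] ℂ) : En n →ₗ[ℂ] ℂ) v
    refine Eq.trans ?_ (this.trans ?_)
    · rfl
    · simp [hl]

lemma IsA.inv {n : ℕ} {f g : En n → En n} (hf : IsA f) (gd : Differentiable ℂ g) (h1 : LeftInverse g f) (h2 : RightInverse g f) : IsA g := by
  refine ⟨⟨gd, f, hf.1.1, h2, h1⟩, fun z => ?_⟩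
  have e : f ∘ g = id := funext h2
  have h3 := fderiv_comp z (hf.1.1 (g z)) (gd z)
  rw [e, fderiv_id] at h3
  have h4 := LinearMap.det_comp (fderiv ℂ f (g z) : En n →ₗ[ℂ] En n) (fderiv ℂ g z : En n →ₗ[ℂ] En n)
  have h5 : LinearMap.det ((fderiv ℂ f (g z) : En n →ₗ[ℂ] En n).comp (fderiv ℂ g z : En n →ₗ[ℂ] En n)) = 1 := by
    have : ((fderiv ℂ f (g z) : En n →ₗ[ℂ] En n).comp (fderiv ℂ g z : En n →ₗ[ℂ] En n)) = LinearMap.id := by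
      have := congrArg (fun A : En n →L[ℂ] En n => (A : En n →ₗ[ℂ] En n)) h3
      exact this.symm
    rw [this, LinearMap.det_id]
  rw [h4] at h5
  have h6 := hf.2 (g z)
  simp only [ContinuousLinearMap.det] at h6 ⊢
  rwa [h6, one_mul] at h5

lemma near_comp_right {n : ℕ} {f : En n → En n} (hf : Continuous f) (R : ℝ) {ε : ℝ} (hε : 0 < ε) :
    ∃ δ > 0, ∀ φ : En n → En n, Near id φ R δ → Near f (f ∘ φ) R ε := by
  have hu := (isCompact_closedBall (0 : En n) (R+1)).uniformContinuousOn_of_continuous hf.continuousOn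
  rw [Metric.uniformContinuousOn_iff_le] at hu
  obtain ⟨δ, hδ, h⟩ := hu ε hε
  refine ⟨min δ 1, by positivity, fun φ hφ z hz => ?_⟩
  have h1 := hφ z hz
  have h2 := h (φ z) (by
    rw [mem_closedBall, dist_zero_right]
    have := norm_sub_norm_le (φ z) z
    have h3 := h1.trans (min_le_right _ _)
    simp only [id] at h3
    linarith) z (by rw [mem_closedBall, dist_zero_right]; linarith) (by rw [dist_eq_norm]; exact h1.trans (min_le_left _ _))
  rwa [dist_eq_norm] at h2

lemma shear_small {n : ℕ} {φ : ℂ → ℂ} (hφ : Continuous φ) (l : En n →L[ℂ] ℂ) (v : En n) {f : En n → En n} (hf : Continuous f) (R : ℝ) {ε : ℝ} (hε : 0 < ε) :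
    ∃ δ > 0, ∀ t : ℂ, ‖t‖ < δ → ∀ z, ‖z‖ ≤ R → ‖(t * φ (l (f z))) • v‖ ≤ ε := by
  have hc : Continuous fun z => φ (l (f z)) • v := by fun_prop
  obtain ⟨M, hM⟩ := (isCompact_closedBall (0 : En n) R).exists_bound_of_continuousOn hc.continuousOn
  refine ⟨ε/(|M|+1), by positivity, fun t ht z hz => ?_⟩
  rw [mul_smul, norm_smul]
  have := hM z (by simpa using hz)
  calc _ ≤ ε/(|M|+1) * (|M|+1) := by
        gcongr
        linarith [le_abs_self M]
    _ = ε := by field_simp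

lemma iter_near {n : ℕ} {f : En n → En n} (hf : Continuous f) (r : ℝ) (k : ℕ) : ∀ {ε : ℝ}, 0 < ε →
    ∃ R, ∃ δ > 0, ∀ g : En n → En n, Near f g R δ → ∀ x ∈ closedBall (0 : En n) r, ‖g^[k] x - f^[k] x‖ ≤ ε := by
  induction k with
  | zero => intro ε hε; exact ⟨0, 1, one_pos, fun g _ x _ => by simp [hε.le]⟩
  | succ k ih =>
    intro ε hε
    obtain ⟨M, hM⟩ := (isCompact_closedBall (0 : En n) r).exists_bound_of_continuousOn (hf.iterate k).continuousOn
    have hu := (isCompact_closedBall (0 : En n) (M+1)).uniformContinuousOn_of_continuous hf.continuousOn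
    rw [Metric.uniformContinuousOn_iff_le] at hu
    obtain ⟨δ, hδ, h⟩ := hu (ε/2) (by linarith)
    obtain ⟨R, δ', hδ', h'⟩ := ih (ε := min δ 1) (by positivity)
    refine ⟨max R (M+1), min δ' (ε/2), by positivity, fun g hg x hx => ?_⟩
    have h1 := h' g (hg.mono (le_max_left _ _) (min_le_left _ _)) x hx
    have h2 := hM x hx
    have h3 : ‖g^[k] x‖ ≤ M + 1 := by
      have := norm_sub_norm_le (g^[k] x) (f^[k] x)
      linarith [h1.trans (min_le_right _ _)]
    have h4 := hg (g^[k] x) (h3.trans (le_max_right _ _))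
    have h5 := h (g^[k] x) (by simpa using h3) (f^[k] x) (by rw [mem_closedBall, dist_zero_right]; linarith) (by
      rw [dist_eq_norm]; exact h1.trans (min_le_left _ _))
    rw [dist_eq_norm] at h5
    rw [iterate_succ_apply', iterate_succ_apply']
    have h6 := h4.trans (min_le_right _ _)
    calc _ = ‖(g (g^[k] x) - f (g^[k] x)) + (f (g^[k] x) - f (f^[k] x))‖ := by congr 1; abel
      _ ≤ _ := norm_add_le _ _
      _ ≤ ε := by linarith

/-- pointwise conditions on iterates are open. -/
lemma open_iter {n : ℕ} {f : En n → En n} (hf : Continuous f) (p : En n) (k : ℕ) {O : Set (En n)} (hO : IsOpen O) (h : f^[k] p ∈ O) :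
    ∃ R, ∃ δ > 0, ∀ g : En n → En n, Near f g R δ → g^[k] p ∈ O := by
  obtain ⟨ε, hε, hb⟩ := Metric.isOpen_iff.1 hO _ h
  obtain ⟨R, δ, hδ, hh⟩ := iter_near hf ‖p‖ k (ε := ε/2) (by linarith)
  refine ⟨R, δ, hδ, fun g hg => hb ?_⟩
  rw [mem_ball, dist_eq_norm]
  linarith [hh g hg p (by simp)]

lemma dense_D1 {n : ℕ} (hn : 2 ≤ n) {U : Set (En n)} (hU : IsOpen U) (hne : U.Nonempty) (R : ℝ) :
    DenseP (fun f : En n → En n => ∃ p ∈ U, ∃ k : ℕ, R < ‖f^[k] p‖) := by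
  intro f hf R' ε hε
  obtain ⟨⟨fd, g, gd, h1, h2⟩, fv⟩ := hf
  obtain ⟨φ, l, v, hφ, hl, hh⟩ := escape hn fd gd h1 h2 fv hU hne R
  obtain ⟨δ, hδ, hs⟩ := shear_small hφ.continuous l v fd.continuous R' hε
  obtain ⟨t, ht, hp⟩ := hh δ hδ
  refine ⟨_, ?_, fun z hz => ?_, hp⟩
  · exact (isA_shear (φ := fun x => t * φ x) (hφ.const_mul t) hl).comp ⟨⟨fd, g, gd, h1, h2⟩, fv⟩
  · simpa using hs t ht z hz

lemma open_D1 {n : ℕ} (U : Set (En n)) (R : ℝ) :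
    OpenP (fun f : En n → En n => ∃ p ∈ U, ∃ k : ℕ, R < ‖f^[k] p‖) := by
  rintro f hf ⟨p, hp, k, hk⟩
  obtain ⟨R', δ, hδ, h⟩ := open_iter hf.1.1.continuous p k (O := {z | R < ‖z‖}) (isOpen_lt continuous_const continuous_norm) hk
  exact ⟨R', δ, hδ, fun g _ hg => ⟨p, hp, k, h g hg⟩⟩

lemma dense_D2 {n : ℕ} (hn : 2 ≤ n) {V : Set (En n)} (hV : IsOpen V) (hne : V.Nonempty) (R : ℝ) :
    DenseP (fun f : En n → En n => ∃ x, R < ‖x‖ ∧ ∃ k : ℕ, f^[k] x ∈ V) := by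
  intro f hf R' ε hε
  obtain ⟨⟨fd, g, gd, h1, h2⟩, fv⟩ := id hf
  have hg := hf.inv gd h1 h2
  obtain ⟨φ, l, v, hφ, hl, hh⟩ := escape hn gd fd h2 h1 hg.2 hV hne R
  obtain ⟨ε', hε', hnr⟩ := near_comp_right fd.continuous R' hε
  obtain ⟨δ, hδ, hs⟩ := shear_small hφ.continuous l v continuous_id R' hε'
  obtain ⟨t, ht, q, hq, k, hk⟩ := hh δ hδ
  have hS : IsA (fun z : En n => z + (-(t * φ (l z))) • v) := isA_shear (φ := fun x => -(t * φ x)) (hφ.const_mul t).neg hl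
  refine ⟨f ∘ (fun z : En n => z + (-(t * φ (l z))) • v), hf.comp hS, hnr _ fun z hz => ?_, _, hk, k, ?_⟩
  · have := hs t ht z hz
    simpa [neg_smul] using this
  · have hinv : LeftInverse (f ∘ (fun z : En n => z + (-(t * φ (l z))) • v)) (fun z => g z + (t * φ (l (g z))) • v) := by
      intro z
      simp [hl, h2 z]
    rw [hinv.iterate k q]; exact hq

lemma open_D2 {n : ℕ} {V : Set (En n)} (hV : IsOpen V) (R : ℝ) :
    OpenP (fun f : En n → En n => ∃ x, R < ‖x‖ ∧ ∃ k : ℕ, f^[k] x ∈ V) := by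
  rintro f hf ⟨x, hx, k, hk⟩
  obtain ⟨R', δ, hδ, h⟩ := open_iter hf.1.1.continuous x k hV hk
  exact ⟨R', δ, hδ, fun g _ hg => ⟨x, hx, k, h g hg⟩⟩

/-- Dense after an open condition. -/
lemma DenseP.open_step {n : ℕ} {P Q : (En n → En n) → Prop} (hP : OpenP P) (hQ : DenseP Q) {f : En n → En n} (hf : IsA f) (hPf : P f)
    (R : ℝ) {ε : ℝ} (hε : 0 < ε) : ∃ g, IsA g ∧ Near f g R ε ∧ P g ∧ Q g := by
  obtain ⟨R', ε', hε', h⟩ := hP f hf hPf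
  obtain ⟨g, hg, hn, hQg⟩ := hQ f hf (max R R') (min ε ε') (by positivity)
  exact ⟨g, hg, hn.mono (le_max_left _ _) (min_le_left _ _), h g hg (hn.mono (le_max_right _ _) (min_le_right _ _)), hQg⟩


lemma interp {s : Finset ℂ} {ζ0 : ℂ} (hs : ζ0 ∉ s) {ρ : ℝ} (hρ : 0 ≤ ρ) (h : ρ < ‖ζ0‖) {ε : ℝ} (hε : 0 < ε) :
    ∃ φ : ℂ → ℂ, Differentiable ℂ φ ∧ φ ζ0 = 1 ∧ (∀ τ ∈ s, φ τ = 0) ∧ ∀ ζ, ‖ζ‖ ≤ ρ → ‖φ ζ‖ ≤ ε := by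
  have h0 : 0 < ‖ζ0‖ := hρ.trans_lt h
  have hz0 : ζ0 ≠ 0 := norm_pos_iff.1 h0
  obtain ⟨M, hM⟩ := (isCompact_closedBall (0:ℂ) ρ).exists_bound_of_continuousOn (ipoly_diff s ζ0).continuous.continuousOn
  have hM0 : 0 ≤ M := (norm_nonneg _).trans (hM 0 (by simpa using hρ))
  obtain ⟨N, hN⟩ := exists_pow_lt_of_lt_one (x := ε/(M+1)) (by positivity) ((div_lt_one h0).2 h)
  refine ⟨fun ζ => (ζ/ζ0)^N * ipoly s ζ0 ζ, ((differentiable_id.div_const ζ0).pow N).mul (ipoly_diff s ζ0), ?_, ?_, ?_⟩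
  · simp [hz0, ipoly_self hs]
  · intro τ hτ; simp [ipoly_mem hτ]
  · intro ζ hζ
    rw [norm_mul, norm_pow, norm_div]
    have := hM ζ (by simpa using hζ)
    calc _ ≤ (ρ/‖ζ0‖)^N * (M+1) := by gcongr; linarith
      _ ≤ ε/(M+1) * (M+1) := by gcongr
      _ = ε := by field_simp

lemma push {n : ℕ} {S : Set (En n)} (hS : S.Finite) {w b : En n} {R : ℝ} (hR : 0 ≤ R) (hw : R * ‖w‖ < ‖inner ℂ w b‖)
    (hsep : ∀ s ∈ S, inner ℂ w (b - s) ≠ 0) (v : En n) (hv : inner ℂ w v = 0) {ε : ℝ} (hε : 0 < ε) :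
    ∃ φ : En n → En n, IsA φ ∧ Near id φ R ε ∧ (∀ s ∈ S, φ s = s) ∧ ∀ x, inner ℂ w x = inner ℂ w b → φ x = x + v := by
  classical
  have hs : inner ℂ w b ∉ (hS.image (fun s => inner ℂ w s)).toFinset := by
    simp only [Finite.mem_toFinset, mem_image, not_exists, not_and]
    intro s hs he
    refine hsep s hs ?_
    rw [inner_sub_right, he, sub_self]
  obtain ⟨φ, hφd, h1, h2, h3⟩ := interp hs (by positivity) hw (ε := ε/(‖v‖+1)) (by positivity)
  refine ⟨fun z => z + φ (innerSL ℂ w z) • v, isA_shear hφd (by simpa using hv), fun z hz => ?_, fun s hs => ?_, fun x hx => ?_⟩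
  · have : ‖φ (inner ℂ w z)‖ ≤ ε/(‖v‖+1) := h3 _ ((norm_inner_le_norm w z).trans (by rw [mul_comm]; gcongr))
    simp only [id, add_sub_cancel_left, norm_smul, innerSL_apply_apply]
    calc _ ≤ ε/(‖v‖+1) * (‖v‖+1) := by gcongr; linarith
      _ = ε := by field_simp
  · have := h2 (inner ℂ w s) (by simpa using ⟨s, hs, rfl⟩)
    simp [innerSL_apply_apply, this]
  · simp [innerSL_apply_apply, hx, h1]

lemma move {n : ℕ} (hn : 2 ≤ n) {S : Set (En n)} (hS : S.Finite) {a b : En n} (ha : a ∉ S) (hb : b ∉ S) {R : ℝ} (hR : 0 ≤ R)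
    (hRa : R < ‖a‖) (hRb : R < ‖b‖) {ε : ℝ} (hε : 0 < ε) :
    ∃ φ : En n → En n, IsA φ ∧ Near id φ R ε ∧ (∀ s ∈ S, φ s = s) ∧ φ b = a := by
  obtain ⟨R', hRR', hR'⟩ := exists_between (lt_min hRa hRb)
  have hR'a := hR'.trans_le (min_le_left _ _)
  have hR'b := hR'.trans_le (min_le_right _ _)
  have hR'0 : 0 ≤ R' := hR.trans hRR'.le
  have hopen : ∀ c : En n, IsOpen {w : En n | R' * ‖w‖ < ‖inner ℂ w c‖} := fun c =>
    isOpen_lt (by fun_prop) (by fun_prop)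
  have hmem : ∀ c : En n, R' < ‖c‖ → c ∈ {w : En n | R' * ‖w‖ < ‖inner ℂ w c‖} := fun c hc => by
    simp only [mem_setOf_eq, inner_self_eq_norm_sq_to_K, norm_pow]
    have : ‖((‖c‖ : ℝ) : ℂ)‖ = ‖c‖ := by simp
    erw [this]
    nlinarith
  obtain ⟨w1, hw1, hg1⟩ := (gen_dense ((fun s => b - s) '' S) (hS.image _) (by
    rintro _ ⟨s, hs, rfl⟩
    rw [sub_ne_zero]; rintro rfl; exact hb hs)).inter_open_nonempty _ (hopen b) ⟨b, hmem b hR'b⟩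
  obtain ⟨v, hv0, hv⟩ := exists_ker hn (innerSL ℂ w1)
  obtain ⟨w2, hw2, hg2⟩ := (gen_dense (((fun s => a - s) '' S) ∪ {v}) ((hS.image _).union (finite_singleton v)) (by
    rintro _ (⟨s, hs, rfl⟩ | rfl)
    · rw [sub_ne_zero]; rintro rfl; exact ha hs
    · exact hv0)).inter_open_nonempty _ (hopen a) ⟨a, hmem a hR'a⟩
  have hv2 : inner ℂ w2 v ≠ 0 := hg2 v (by simp)
  set v1 : En n := ((inner ℂ w2 v)⁻¹ * inner ℂ w2 (a - b)) • v with hv1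
  obtain ⟨φ1, hA1, hn1, hf1, hm1⟩ := push hS hR'0 hw1 (fun s hs => hg1 _ ⟨s, hs, rfl⟩) v1 (by
    rw [hv1, inner_smul_right]
    have : inner ℂ w1 v = 0 := by simpa using hv
    rw [this, mul_zero]) (ε := min (ε/2) (R' - R)) (lt_min (by linarith) (by linarith))
  have hv1' : inner ℂ w2 v1 = inner ℂ w2 (a - b) := by
    rw [hv1, inner_smul_right]; field_simp
  obtain ⟨φ2, hA2, hn2, hf2, hm2⟩ := push hS hR'0 hw2 (fun s hs => hg2 _ (Or.inl ⟨s, hs, rfl⟩)) (a - (b + v1)) (by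
    rw [← sub_sub, inner_sub_right, hv1', sub_self]) (ε := ε/2) (by linarith)
  refine ⟨φ2 ∘ φ1, hA2.comp hA1, fun z hz => ?_, fun s hs => ?_, ?_⟩
  · have h1 := hn1 z (hz.trans hRR'.le)
    have h1a := h1.trans (min_le_left _ _)
    have h1b := h1.trans (min_le_right _ _)
    simp only [id] at h1a h1b
    have h2 := hn2 (φ1 z) (by linarith [norm_sub_norm_le (φ1 z) z])
    simp only [id, comp_apply] at h2 ⊢
    calc _ = ‖(φ2 (φ1 z) - φ1 z) + (φ1 z - z)‖ := by congr 1; abel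
      _ ≤ _ := norm_add_le _ _
      _ ≤ ε := by linarith
  · simp [hf1 s hs, hf2 s hs]
  · rw [comp_apply, hm1 b rfl, hm2 (b + v1) (by rw [inner_add_right, hv1', inner_sub_right]; ring)]
    abel

lemma iter_agree {α : Type*} {f g : α → α} {x : α} {k : ℕ} (h : ∀ j < k, g (f^[j] x) = f (f^[j] x)) : ∀ j ≤ k, g^[j] x = f^[j] x := by
  intro j
  induction j with
  | zero => intro _; rfl
  | succ j ih =>
    intro hj
    rw [iterate_succ_apply', iterate_succ_apply', ih (by omega), h j (by omega)]

lemma connect {n : ℕ} (hn : 2 ≤ n) {U V : Set (En n)} (hU : IsOpen U) (hUne : U.Nonempty) (hV : IsOpen V) (hVne : V.Nonempty) :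
    DenseP (fun f : En n → En n => ∃ p ∈ U, ∃ k : ℕ, f^[k] p ∈ V) := by
  classical
  intro f hf R ε hε
  obtain ⟨u, hu⟩ := hUne
  obtain ⟨v, hv⟩ := hVne
  set R1 := max (max R 0) (max ‖u‖ ‖v‖) + 1 with hR1
  have hRR1 : R ≤ R1 := by
    have : R ≤ max (max R 0) (max ‖u‖ ‖v‖) := by simp
    linarith
  have hR10 : 0 ≤ R1 := by
    have : 0 ≤ max (max R 0) (max ‖u‖ ‖v‖) := by simp
    linarith
  have hu1 : ‖u‖ < R1 := by
    have : ‖u‖ ≤ max (max R 0) (max ‖u‖ ‖v‖) := by simp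
    linarith
  have hv1 : ‖v‖ < R1 := by
    have : ‖v‖ ≤ max (max R 0) (max ‖u‖ ‖v‖) := by simp
    linarith
  obtain ⟨f1, hf1, hn1, hP1⟩ := dense_D1 hn (hU.inter (isOpen_ball (x := (0 : En n)) (ε := R1))) ⟨u, hu, by simpa using hu1⟩ R1 f hf R1 (ε/3) (by linarith)
  obtain ⟨f2, hf2, hn2, hP2, hQ2⟩ := DenseP.open_step (open_D1 _ _) (dense_D2 hn (hV.inter (isOpen_ball (x := (0 : En n)) (ε := R1))) ⟨v, hv, by simpa using hv1⟩ R1) hf1 hP1 R1 (ε := ε/3) (by linarith)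
  obtain ⟨p, hp, hex⟩ := hP2
  have hex2 : ∃ i, ∃ x, R1 < ‖x‖ ∧ f2^[i] x ∈ V ∩ ball 0 R1 := by
    obtain ⟨x, hx, i, hi⟩ := hQ2; exact ⟨i, x, hx, hi⟩
  set k := Nat.find hex with hk
  have hkb : R1 < ‖f2^[k] p‖ := Nat.find_spec hex
  have hkm : ∀ j < k, ‖f2^[j] p‖ ≤ R1 := fun j hj => not_lt.1 (Nat.find_min hex hj)
  set i := Nat.find hex2 with hi
  obtain ⟨a, haR, haV⟩ : ∃ x, R1 < ‖x‖ ∧ f2^[i] x ∈ V ∩ ball 0 R1 := Nat.find_spec hex2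
  have him : ∀ j, 0 < j → j ≤ i → ‖f2^[j] a‖ ≤ R1 := fun j hj hji => by
    by_contra hc
    refine Nat.find_min hex2 (m := i - j) (by omega) ⟨f2^[j] a, not_le.1 hc, ?_⟩
    rw [← iterate_add_apply, Nat.sub_add_cancel hji]; exact haV
  have hi0 : 0 < i := by
    rcases Nat.eq_zero_or_pos i with h0 | h0
    · rw [h0] at haV
      have := haV.2
      simp at this
      linarith
    · exact h0
  set S : Set (En n) := ((fun j => f2^[j] p) '' Iio k) ∪ ((fun j => f2^[j] a) '' Ioc 0 i) with hS
  have hSR : ∀ s ∈ S, ‖s‖ ≤ R1 := by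
    rintro _ (⟨j, hj, rfl⟩ | ⟨j, hj, rfl⟩)
    · exact hkm j hj
    · exact him j hj.1 hj.2
  obtain ⟨δ, hδ, hδn⟩ := near_comp_right hf2.1.1.continuous R1 (ε := ε/3) (by linarith)
  obtain ⟨φ, hφA, hφn, hφS, hφb⟩ := move hn (S := S) (((finite_Iio k).image _).union ((finite_Ioc 0 i).image _))
    (a := a) (b := f2^[k] p) (fun h => by linarith [hSR _ h]) (fun h => by linarith [hSR _ h]) hR10 haR hkb hδ
  refine ⟨f2 ∘ φ, hf2.comp hφA, ?_, p, hp.1, i + k, ?_⟩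
  · refine ((hn1.trans hn2).trans (hδn φ hφn)).mono hRR1 (by linarith)
  · have h1 : (f2 ∘ φ)^[k] p = f2^[k] p := iter_agree (fun j hj => by
      rw [comp_apply, hφS _ (Or.inl ⟨j, hj, rfl⟩)]) k le_rfl
    have h2 : ∀ j, j < i → (f2 ∘ φ)^[j+1] (f2^[k] p) = f2^[j+1] a := by
      intro j
      induction j with
      | zero => intro _; simp [hφb]
      | succ j ih =>
        intro hj
        rw [iterate_succ_apply', ih (by omega), comp_apply, hφS _ (Or.inr ⟨j+1, ⟨by omega, by omega⟩, rfl⟩), ← iterate_succ_apply' f2]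
    rw [iterate_add_apply, h1]
    obtain ⟨i', hi'⟩ : ∃ i', i = i' + 1 := ⟨i - 1, by omega⟩
    have h3 := h2 i' (by omega)
    rw [← hi'] at h3
    rw [h3]
    exact haV.1

lemma open_maps {n : ℕ} {f : En n → En n} (hf : Continuous f) {K O : Set (En n)} (hK : IsCompact K) (k : ℕ) (hO : IsOpen O) (h : MapsTo (f^[k]) K O) :
    ∃ R, ∃ δ > 0, ∀ g : En n → En n, Near f g R δ → MapsTo (g^[k]) K O := by
  obtain ⟨ε, hε, hb⟩ := (hK.image (hf.iterate k)).exists_cthickening_subset_open hO h.image_subset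
  obtain ⟨r, hr⟩ := hK.isBounded.subset_closedBall 0
  obtain ⟨R, δ, hδ, hh⟩ := iter_near hf r k hε
  refine ⟨R, δ, hδ, fun g hg x hx => hb ?_⟩
  refine mem_cthickening_of_dist_le _ (f^[k] x) _ _ (mem_image_of_mem _ hx) ?_
  rw [dist_eq_norm]
  exact hh g hg x (hr hx)

lemma openP_maps {n : ℕ} {K O : Set (En n)} (hK : IsCompact K) (k : ℕ) (hO : IsOpen O) :
    OpenP (fun f : En n → En n => MapsTo (f^[k]) K O) := by
  intro f hf h
  obtain ⟨R, δ, hδ, hh⟩ := open_maps hf.1.1.continuous hK k hO h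
  exact ⟨R, δ, hδ, fun g _ hg => hh g hg⟩

lemma OpenP.and {n : ℕ} {P Q : (En n → En n) → Prop} (hP : OpenP P) (hQ : OpenP Q) : OpenP (fun f => P f ∧ Q f) := by
  rintro f hf ⟨h1, h2⟩
  obtain ⟨R, ε, hε, h⟩ := hP f hf h1
  obtain ⟨R', ε', hε', h'⟩ := hQ f hf h2
  exact ⟨max R R', min ε ε', by positivity, fun g hg hn => ⟨h g hg (hn.mono (le_max_left _ _) (min_le_left _ _)),
    h' g hg (hn.mono (le_max_right _ _) (min_le_right _ _))⟩⟩

lemma ball_maps {n : ℕ} {f : En n → En n} (hf : Continuous f) {U O : Set (En n)} (hU : IsOpen U) (hO : IsOpen O) {p : En n} (hp : p ∈ U) {k : ℕ}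
    (h : f^[k] p ∈ O) : ∃ r > 0, closedBall p r ⊆ U ∧ MapsTo (f^[k]) (closedBall p r) O := by
  have : U ∩ (f^[k])⁻¹' O ∈ 𝓝 p := (hU.inter (hO.preimage (hf.iterate k))).mem_nhds ⟨hp, h⟩
  obtain ⟨r, hr, hsub⟩ := Metric.nhds_basis_closedBall.mem_iff.1 this
  exact ⟨r, hr, fun x hx => (hsub hx).1, fun x hx => (hsub hx).2⟩

def HasCyc {n : ℕ} (f : En n → En n) (U V : Set (En n)) : Prop :=
  ∃ p, ∃ k : ℕ, 0 < k ∧ f^[k] p = p ∧ (∃ i, f^[i] p ∈ U) ∧ ∃ i, f^[i] p ∈ V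

lemma dense_cyc {n : ℕ} (hn : 2 ≤ n) {U V : Set (En n)} (hU : IsOpen U) (hUne : U.Nonempty) (hV : IsOpen V) (hVne : V.Nonempty) :
    DenseP (fun f : En n → En n => HasCyc f U V) := by
  classical
  intro f hf R ε hε
  obtain ⟨u, hu⟩ := hUne
  set R1 := max (max R 0) ‖u‖ + 1 with hR1
  have hRR1 : R ≤ R1 := by
    have : R ≤ max (max R 0) ‖u‖ := by simp
    linarith
  have hR10 : 0 ≤ R1 := by
    have : 0 ≤ max (max R 0) ‖u‖ := by simp
    linarith
  have hu1 : ‖u‖ < R1 := by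
    have : ‖u‖ ≤ max (max R 0) ‖u‖ := by simp
    linarith
  have hU' : IsOpen (U ∩ ball 0 R1) := hU.inter isOpen_ball
  have hU'ne : (U ∩ ball 0 R1).Nonempty := ⟨u, hu, by simpa using hu1⟩
  have hOut : IsOpen {z : En n | R1 < ‖z‖} := isOpen_lt continuous_const continuous_norm
  obtain ⟨f0, hf0, hn0, q, hq, l, hl⟩ := dense_D1 hn hV hVne R1 f hf R1 (ε/4) (by linarith)
  obtain ⟨r, hr, hrV, hrM⟩ := ball_maps hf0.1.1.continuous hV hOut hq (k := l) hl
  have hO1 := openP_maps (isCompact_closedBall q r) l hOut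
  obtain ⟨f1, hf1, hn1, hP1, p, hp, k, hk⟩ := DenseP.open_step hO1
    (connect hn hU' hU'ne (isOpen_ball (x := q) (ε := r)) ⟨q, mem_ball_self hr⟩) hf0 hrM R1 (ε := ε/4) (by linarith)
  obtain ⟨r2, hr2, hr2U, hr2M⟩ := ball_maps hf1.1.1.continuous hU' isOpen_ball hp hk
  have hO2 := hO1.and (openP_maps (isCompact_closedBall p r2) k (isOpen_ball (x := q) (ε := r)))
  obtain ⟨f2, hf2, hn2, ⟨hP2, hP2'⟩, x, hx, i, hi⟩ := DenseP.open_step hO2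
    (dense_D2 hn (isOpen_ball (x := p) (ε := r2)) ⟨p, mem_ball_self hr2⟩ R1) hf1 ⟨hP1, hr2M⟩ R1 (ε := ε/4) (by linarith)
  have hiU := hr2U (ball_subset_closedBall hi)
  have hkq : f2^[k+i] x ∈ ball q r := by
    rw [iterate_add_apply]; exact hP2' (ball_subset_closedBall hi)
  have hkV : f2^[k+i] x ∈ V := hrV (ball_subset_closedBall hkq)
  have hls : R1 < ‖f2^[l+(k+i)] x‖ := by
    rw [iterate_add_apply]; exact hP2 (ball_subset_closedBall hkq)
  have hn' : Near f f2 R1 (3*ε/4) := ((hn0.trans hn1).trans hn2).mono le_rfl (by linarith)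
  have hi0 : 0 < i := by
    rcases Nat.eq_zero_or_pos i with h0 | h0
    · rw [h0] at hiU
      have := hiU.2
      simp at this
      linarith
    · exact h0
  by_cases hper : ∃ d, 0 < d ∧ f2^[d] x = x
  · obtain ⟨d, hd, hdx⟩ := hper
    exact ⟨f2, hf2, hn'.mono hRR1 (by linarith), x, d, hd, hdx, ⟨i, hiU.1⟩, ⟨k+i, hkV⟩⟩
  push Not at hper
  set s := l + (k+i) with hs
  have hinj : Injective f2 := by
    obtain ⟨⟨-, g, -, h1, -⟩, -⟩ := hf2
    exact h1.injective
  set S : Set (En n) := (fun j => f2^[j] x) '' Ioo 0 s with hS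
  obtain ⟨δ, hδ, hδn⟩ := near_comp_right hf2.1.1.continuous R1 (ε := ε/4) (by linarith)
  obtain ⟨φ, hφA, hφn, hφS, hφb⟩ := move hn (S := S) ((finite_Ioo 0 s).image _) (a := x) (b := f2^[s] x)
    (by rintro ⟨j, hj, he⟩; exact hper j hj.1 he)
    (by
      rintro ⟨j, hj, he⟩
      refine hper (s - j) (by have := hj.2; omega) ?_
      have he' : f2^[j] x = f2^[s] x := he
      rw [← Nat.add_sub_cancel' hj.2.le, iterate_add_apply] at he'
      exact (hinj.iterate j he').symm) hR10 hx hls hδ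
  refine ⟨f2 ∘ φ, hf2.comp hφA, (hn'.trans (hδn φ hφn)).mono hRR1 (by linarith), f2 x, s, by omega, ?_⟩
  have h2 : ∀ j, j < s → (f2 ∘ φ)^[j] (f2 x) = f2^[j+1] x := by
    intro j
    induction j with
    | zero => intro _; simp
    | succ j ih =>
      intro hj
      rw [iterate_succ_apply', ih (by omega), comp_apply, hφS _ ⟨j+1, ⟨by omega, by omega⟩, rfl⟩, ← iterate_succ_apply' f2]
  refine ⟨?_, ⟨i-1, ?_⟩, ⟨k+i-1, ?_⟩⟩
  · obtain ⟨s', hs'⟩ : ∃ s', s = s' + 1 := ⟨s - 1, by omega⟩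
    have h3 := h2 s' (by omega)
    rw [← hs'] at h3
    nth_rewrite 1 [hs']
    rw [iterate_succ_apply', h3, comp_apply, hφb]
  · rw [h2 _ (by omega), Nat.sub_add_cancel (by omega)]; exact hiU.1
  · rw [h2 _ (by omega), Nat.sub_add_cancel (by omega)]; exact hkV



lemma lin_choice {n : ℕ} (hn : 2 ≤ n) (M : En n →L[ℂ] En n) {w : En n} (hw : w ≠ 0) (hM : M w = w)
    {S : Set (En n)} (hS : S.Finite) (h0 : ∀ u ∈ S, u ≠ 0) :
    ∃ l : En n →L[ℂ] ℂ, ∃ v : En n, l v = 0 ∧ l w ≠ 0 ∧ (∀ u ∈ S, l u ≠ 0) ∧ ∀ x, M x - x ≠ v := by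
  have hns : ¬ ∀ v, ∃ x, M x - x = v := by
    intro h
    have hi : Injective ((M - ContinuousLinearMap.id ℂ _ : En n →L[ℂ] En n) : En n →ₗ[ℂ] En n) := by
      rw [LinearMap.injective_iff_surjective]
      intro v
      obtain ⟨x, hx⟩ := h v
      exact ⟨x, by simpa using hx⟩
    apply hw
    apply hi
    simp [hM]
  by_cases hT : ∀ x, M x - x = 0
  · obtain ⟨a, ha⟩ := (gen_dense (insert w S) (hS.insert w) (by
      rintro u (rfl | hu)
      · exact hw
      · exact h0 u hu)).nonempty
    obtain ⟨v, hv0, hv⟩ := exists_ker hn (innerSL ℂ a)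
    refine ⟨innerSL ℂ a, v, hv, ?_, fun u hu => ?_, fun x => ?_⟩
    · simpa using ha w (mem_insert _ _)
    · simpa using ha u (mem_insert_of_mem _ hu)
    · rw [hT]; exact hv0.symm
  · push Not at hT
    obtain ⟨y, hy⟩ := hT
    obtain ⟨a, ha⟩ := (gen_dense (insert (M y - y) (insert w S)) ((hS.insert w).insert _) (by
      rintro u (rfl | rfl | hu)
      · exact hy
      · exact hw
      · exact h0 u hu)).nonempty
    set l := innerSL ℂ a with hl
    have hly : l (M y - y) ≠ 0 := by
      have := ha _ (mem_insert _ _)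
      rwa [← innerSL_apply_apply ℂ] at this
    by_contra! hc
    apply hns
    intro v
    obtain ⟨x, hx⟩ := hc l (v - (l v / l (M y - y)) • (M y - y)) (by
      rw [map_sub, map_smul, smul_eq_mul, div_mul_cancel₀ _ hly, sub_self]) (by
        simpa [hl] using ha w (mem_insert_of_mem _ (mem_insert _ _))) (fun u hu => by
        simpa [hl] using ha u (mem_insert_of_mem _ (mem_insert_of_mem _ hu)))
    refine ⟨x + (l v / l (M y - y)) • y, ?_⟩
    rw [map_add, map_smul]
    have : M x = x + (v - (l v / l (M y - y)) • (M y - y)) := by rw [← hx]; abel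
    rw [this, smul_sub]; abel

lemma trans_step {n : ℕ} (hn : 2 ≤ n) {f : En n → En n} (hf : IsA f) {p : En n} {k : ℕ} (hk : 0 < k)
    (hper : f^[k] p = p) (hinj : Set.InjOn (fun i : ℕ => f^[i] p) (Set.Iio k))
    (hev : Module.End.HasEigenvalue ((fderiv ℂ (f^[k]) p : En n →ₗ[ℂ] En n) : Module.End ℂ (En n)) 1)
    (R : ℝ) {ε : ℝ} (hε : 0 < ε) :
    ∃ g, IsA g ∧ Near f g R ε ∧ (∀ i, g^[i] p = f^[i] p) ∧
      Module.finrank ℂ (Module.End.eigenspace ((fderiv ℂ (g^[k]) p : En n →ₗ[ℂ] En n) : Module.End ℂ (En n)) 1) <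
      Module.finrank ℂ (Module.End.eigenspace ((fderiv ℂ (f^[k]) p : En n →ₗ[ℂ] En n) : Module.End ℂ (En n)) 1) := by
  classical
  obtain ⟨w, hw⟩ := hev.exists_hasEigenvector
  have hw0 : w ≠ 0 := hw.2
  have hMw : fderiv ℂ (f^[k]) p w = w := by simpa using hw.apply_eq_smul
  set M := fderiv ℂ (f^[k]) p with hM
  obtain ⟨l, v, hlv, hlw, hlS, hv⟩ := lin_choice hn M hw0 hMw (S := (fun i => f^[i] p - p) '' (Ioo 0 k))
    ((finite_Ioo 0 k).image _) (by
      rintro _ ⟨i, hi, rfl⟩ h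
      rw [sub_eq_zero] at h
      have := @hinj i hi.2 0 hk h
      exact hi.1.ne' this)
  have hl : ∀ i ∈ Ioo 0 k, l (f^[i] p) ≠ l p := fun i hi h => hlS _ ⟨i, hi, rfl⟩ (by rw [map_sub, h, sub_self])
  set s : Finset ℂ := (Finset.Ioo 0 k).image (fun j => l (f^[j] p)) with hs
  have hnot : l p ∉ s := by
    rw [hs, Finset.mem_image]
    rintro ⟨j, hj, he⟩
    rw [Finset.mem_Ioo] at hj
    exact hl j hj he
  have hmem : ∀ i ∈ Ioo 0 k, l (f^[i] p) ∈ s := fun i hi =>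
    Finset.mem_image_of_mem _ (Finset.mem_Ioo.2 hi)
  set P := ipoly s (l p) with hP
  have hPd : Differentiable ℂ P := ipoly_diff _ _
  set φ : ℂ → ℂ := fun ζ => (ζ - l p) * P ζ ^ 2 with hφ
  have hφd : Differentiable ℂ φ := by fun_prop
  have hder : ∀ ζ, deriv φ ζ = P ζ ^ 2 + (ζ - l p) * (2 * P ζ * deriv P ζ) := by
    intro ζ
    have h1 : HasDerivAt (fun ζ => ζ - l p) 1 ζ := (hasDerivAt_id ζ).sub_const _
    have h2 := (hPd ζ).hasDerivAt.pow 2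
    have h3 := h1.mul h2
    have : φ = (fun ζ => ζ - l p) * P ^ 2 := rfl
    rw [this, h3.deriv]
    simp
  have hφ0 : φ (l p) = 0 := by simp [hφ]
  have hdφ0 : deriv φ (l p) = 1 := by rw [hder, hP, ipoly_self hnot]; simp
  have hφi : ∀ i ∈ Ioo 0 k, φ (l (f^[i] p)) = 0 := fun i hi => by
    simp only [hφ]; rw [hP, ipoly_mem (hmem i hi)]; simp
  have hdφi : ∀ i ∈ Ioo 0 k, deriv φ (l (f^[i] p)) = 0 := fun i hi => by
    rw [hder, hP, ipoly_mem (hmem i hi)]; simp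
  obtain ⟨ε', hε', hnr⟩ := near_comp_right hf.1.1.continuous R hε
  obtain ⟨δ, hδ, hsm⟩ := shear_small hφd.continuous l v continuous_id R hε'
  set t : ℂ := ((δ/2 : ℝ) : ℂ) with ht
  have ht0 : t ≠ 0 := by
    rw [ht]; exact_mod_cast (by positivity : (δ/2:ℝ) ≠ 0)
  have htn : ‖t‖ < δ := by rw [ht, Complex.norm_real, Real.norm_of_nonneg (by positivity)]; linarith
  set ψ : En n → En n := fun z => z + (t * φ (l z)) • v with hψ
  have htφ : Differentiable ℂ (fun ζ => t * φ ζ) := hφd.const_mul t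
  have hψA : IsA ψ := isA_shear (φ := fun ζ => t * φ ζ) htφ hlv
  have hψd : ∀ z, HasFDerivAt ψ (ContinuousLinearMap.id ℂ _ + ((t * deriv φ (l z)) • l).smulRight v) z := by
    intro z
    have := shear_fderiv htφ l v z
    rwa [deriv_const_mul _ (hφd _)] at this
  have hgA : IsA (f ∘ ψ) := hf.comp hψA
  have hψfix : ∀ i < k, ψ (f^[i] p) = f^[i] p := by
    intro i hi
    rcases Nat.eq_zero_or_pos i with rfl | h0
    · simp [hψ, hφ0]
    · simp [hψ, hφi i ⟨h0, hi⟩]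
  have horb : ∀ i, (f ∘ ψ)^[i] p = f^[i] p := by
    intro i
    induction i with
    | zero => rfl
    | succ i ih =>
      rw [iterate_succ_apply', iterate_succ_apply', ih]
      have hp : f^[i] p = f^[i % k] p := by
        have : IsPeriodicPt f k p := hper
        exact (this.iterate_mod_apply i).symm
      simp only [comp]
      rw [hp, hψfix _ (Nat.mod_lt _ hk)]
  have hgd : ∀ z, fderiv ℂ (f ∘ ψ) z = (fderiv ℂ f (ψ z)).comp (fderiv ℂ ψ z) := fun z =>
    fderiv_comp z (hf.1.1 _) (hψA.1.1 _)
  have hD : ∀ j, j + 1 ≤ k → fderiv ℂ ((f ∘ ψ)^[j]) (f p) = fderiv ℂ (f^[j]) (f p) := by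
    intro j
    induction j with
    | zero => intro _; rfl
    | succ j ih =>
      intro hj
      have e1 : (f ∘ ψ)^[j] (f p) = f^[j+1] p := by
        have := horb (j+1)
        rw [iterate_succ_apply] at this
        have h1 := horb 1
        simp only [iterate_one] at h1
        rwa [h1] at this
      have e2 : f^[j] (f p) = f^[j+1] p := rfl
      rw [add_comm j 1, fderiv_iter_add hgA.1.1, fderiv_iter_add hf.1.1, ih (by omega), e1, e2]
      congr 1
      rw [iterate_one, iterate_one, hgd, hψfix _ (by omega), (hψd _).fderiv, hdφi (j+1) ⟨by omega, by omega⟩]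
      ext x; simp
  have hM' : ∀ x, fderiv ℂ ((f ∘ ψ)^[k]) p x = M x + (t * l x) • M v := by
    intro x
    obtain ⟨m, rfl⟩ : ∃ m, k = m + 1 := ⟨k - 1, by omega⟩
    have h1 := horb 1
    simp only [iterate_one] at h1
    rw [hM, fderiv_iter_add hgA.1.1, fderiv_iter_add hf.1.1, iterate_one, iterate_one, h1, hD m le_rfl, hgd,
      show ψ p = p from hψfix 0 hk, (hψd _).fderiv, hdφ0]
    simp [mul_smul]
  refine ⟨f ∘ ψ, hgA, hnr ψ fun z hz => ?_, horb, ?_⟩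
  · simpa [hψ] using hsm t htn z hz
  · apply Submodule.finrank_lt_finrank_of_lt
    have key : ∀ x, fderiv ℂ ((f ∘ ψ)^[k]) p x = x → l x = 0 ∧ M x = x := by
      intro x hx
      rw [hM'] at hx
      have hlx : l x = 0 := by
        by_contra hne
        have hc : t * l x ≠ 0 := mul_ne_zero ht0 hne
        apply hv (-((t * l x)⁻¹ • x) - v)
        have : M v = (t * l x)⁻¹ • (x - M x) := by
          rw [eq_inv_smul_iff₀ hc, eq_sub_iff_add_eq, add_comm]; exact hx
        rw [map_sub, map_neg, map_smul, this, smul_sub]; abel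
      exact ⟨hlx, by simpa [hlx] using hx⟩
    rw [SetLike.lt_iff_le_and_exists]
    refine ⟨fun x hx => ?_, w, ?_, fun hx => ?_⟩
    · rw [Module.End.mem_eigenspace_iff, one_smul] at hx ⊢
      exact (key x hx).2
    · rw [Module.End.mem_eigenspace_iff, one_smul]; exact hMw
    · rw [Module.End.mem_eigenspace_iff, one_smul] at hx
      exact hlw (key w hx).1

lemma trans_dense {n : ℕ} (hn : 2 ≤ n) {p : En n} {k : ℕ} (hk : 0 < k) (R : ℝ) : ∀ d : ℕ, ∀ f : En n → En n, IsA f →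
    f^[k] p = p → Set.InjOn (fun i : ℕ => f^[i] p) (Set.Iio k) →
    Module.finrank ℂ (Module.End.eigenspace ((fderiv ℂ (f^[k]) p : En n →ₗ[ℂ] En n) : Module.End ℂ (En n)) 1) ≤ d →
    ∀ ε > 0, ∃ g, IsA g ∧ Near f g R ε ∧ (∀ i, g^[i] p = f^[i] p) ∧
     ¬ Module.End.HasEigenvalue ((fderiv ℂ (g^[k]) p : En n →ₗ[ℂ] En n) : Module.End ℂ (En n)) 1 := by
  intro d
  induction d with
  | zero =>
    intro f hf hper hinj hd ε hε
    refine ⟨f, hf, fun z _ => by simpa using hε.le, fun _ => rfl, ?_⟩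
    rw [Module.End.hasEigenvalue_iff, not_not]
    exact Submodule.finrank_eq_zero.1 (by omega)
  | succ d ih =>
    intro f hf hper hinj hd ε hε
    by_cases hev : Module.End.HasEigenvalue ((fderiv ℂ (f^[k]) p : En n →ₗ[ℂ] En n) : Module.End ℂ (En n)) 1
    · obtain ⟨g, hg, hn1, ho, hlt⟩ := trans_step hn hf hk hper hinj hev R (half_pos hε)
      obtain ⟨h, hh, hn2, ho2, hne⟩ := ih g hg (by rw [ho, hper]) (by
        simp only [ho]; exact hinj) (by omega) (ε/2) (half_pos hε)
      refine ⟨h, hh, fun z hz => ?_, fun i => by rw [ho2, ho], hne⟩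
      have a := hn1 z hz
      have b := hn2 z hz
      have c := norm_add_le (h z - g z) (g z - f z)
      rw [sub_add_sub_cancel] at c
      linarith
    · exact ⟨f, hf, fun z _ => by simpa using hε.le, fun _ => rfl, hev⟩

lemma dense_trans {n : ℕ} (hn : 2 ≤ n) {U V : Set (En n)} (hU : IsOpen U) (hUne : U.Nonempty) (hV : IsOpen V) (hVne : V.Nonempty) :
    DenseP (fun f : En n → En n => HasTransverseCycleThrough f U V) := by
  intro f hf R ε hε
  obtain ⟨g, hg, hn1, p, k, hk, hper, ⟨i, hi⟩, j, hj⟩ := dense_cyc hn hU hUne hV hVne f hf R (ε/2) (half_pos hε)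
  have hper' : IsPeriodicPt g k p := hper
  have hpos := hper'.minimalPeriod_pos hk
  obtain ⟨h, hh, hn2, ho, hne⟩ := trans_dense hn hpos R _ g hg (isPeriodicPt_minimalPeriod g p)
    iterate_injOn_Iio_minimalPeriod le_rfl (ε/2) (half_pos hε)
  refine ⟨h, hh, fun z hz => ?_, p, minimalPeriod g p, hpos, ?_, ?_, hne, ⟨i % minimalPeriod g p, Nat.mod_lt _ hpos, ?_⟩,
    ⟨j % minimalPeriod g p, Nat.mod_lt _ hpos, ?_⟩⟩
  · have a := hn1 z hz
    have b := hn2 z hz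
    have c := norm_add_le (h z - g z) (g z - f z)
    rw [sub_add_sub_cancel] at c
    linarith
  · rw [ho]; exact isPeriodicPt_minimalPeriod g p
  · simp only [ho]; exact iterate_injOn_Iio_minimalPeriod
  · rw [ho, iterate_mod_minimalPeriod_eq]; exact hi
  · rw [ho, iterate_mod_minimalPeriod_eq]; exact hj



lemma OpenP.forall_lt {n : ℕ} {P : ℕ → (En n → En n) → Prop} (hP : ∀ i, OpenP (P i)) (k : ℕ) :
    OpenP (fun f => ∀ i < k, P i f) := by
  induction k with
  | zero => exact fun f _ _ => ⟨0, 1, one_pos, fun g _ _ i hi => absurd hi (Nat.not_lt_zero i)⟩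
  | succ k ih =>
    intro f hf h
    obtain ⟨R, ε, hε, hh⟩ := (ih.and (hP k)) f hf ⟨fun i hi => h i (by omega), h k (by omega)⟩
    refine ⟨R, ε, hε, fun g hg hn i hi => ?_⟩
    obtain ⟨h1, h2⟩ := hh g hg hn
    rcases Nat.lt_succ_iff_lt_or_eq.1 hi with h | rfl
    · exact h1 i h
    · exact h2

lemma open_trans {n : ℕ} {U V : Set (En n)} (hU : IsOpen U) (hV : IsOpen V) :
    OpenP (fun f : En n → En n => HasTransverseCycleThrough f U V) := by
  rintro f hf ⟨p, k, hk, hper, hinj, hev, ⟨iU, hiU, hpU⟩, ⟨iV, hiV, hpV⟩⟩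
  have hfc := hf.1.1.continuous
  set M := fderiv ℂ (f^[k]) p with hM
  obtain ⟨Q, hQ1, hQ2⟩ : ∃ Q : En n →L[ℂ] En n, (∀ x, Q (M x - x) = x) ∧ ∀ x, Q x = 0 → x = 0 := by
    have hi : Injective ((M - ContinuousLinearMap.id ℂ _ : En n →L[ℂ] En n) : En n →ₗ[ℂ] En n) := by
      rw [← LinearMap.ker_eq_bot, LinearMap.ker_eq_bot']
      intro x hx
      by_contra hx0
      apply hev
      refine Module.End.hasEigenvalue_of_hasEigenvector (x := x) ⟨?_, hx0⟩
      rw [Module.End.mem_eigenspace_iff, one_smul]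
      exact sub_eq_zero.1 hx
    set e := LinearEquiv.ofInjectiveEndo _ hi with he
    refine ⟨LinearMap.toContinuousLinearMap (e.symm : En n →ₗ[ℂ] En n), fun x => ?_, fun x hx => ?_⟩
    · have : M x - x = e x := rfl
      rw [this]
      exact e.symm_apply_apply x
    · exact (LinearEquiv.map_eq_zero_iff e.symm).1 hx
  set c := ‖Q‖ + 1 with hc
  have hc0 : 0 < c := by positivity
  obtain ⟨W, hW, hdis⟩ := ((finite_Iio k).image (fun i => f^[i] p)).t2_separation
  -- choose s
  have ev : ∀ᶠ x in 𝓝 p, ‖fderiv ℂ (f^[k]) x - M‖ ≤ 1/(4*c) ∧ f^[iU] x ∈ U ∧ f^[iV] x ∈ V ∧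
      ∀ i ∈ Finset.range k, f^[i] x ∈ W (f^[i] p) := by
    refine Filter.Eventually.and ?_ (Filter.Eventually.and ?_ (Filter.Eventually.and ?_ ?_))
    · have := (cx_cont_fderiv (hf.1.1.iterate k)).continuousAt (x := p)
      rw [Metric.continuousAt_iff'] at this
      filter_upwards [this (1/(4*c)) (by positivity)] with x hx
      rw [dist_eq_norm] at hx
      exact hx.le
    · exact (hfc.iterate iU).continuousAt.eventually (hU.mem_nhds hpU)
    · exact (hfc.iterate iV).continuousAt.eventually (hV.mem_nhds hpV)
    · rw [Filter.eventually_all_finset]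
      intro i _
      exact (hfc.iterate i).continuousAt.eventually ((hW _).2.mem_nhds (hW _).1)
  obtain ⟨s, hs, hsub⟩ := Metric.nhds_basis_closedBall.mem_iff.1 ev
  have hK := isCompact_closedBall p s
  set ε1 := min (1/(8*c)) (s/(2*c)) with hε1
  have hε1p : 0 < ε1 := by positivity
  obtain ⟨R1, δ1, hδ1, h1⟩ := iter_near hfc (‖p‖ + s + 1) k hε1p
  have hO := ((openP_maps hK iU hU).and (openP_maps hK iV hV)).and
    (OpenP.forall_lt (fun i => openP_maps hK i (hW (f^[i] p)).2) k)
  obtain ⟨R2, δ2, hδ2, h2⟩ := hO f hf ⟨⟨fun x hx => (hsub hx).2.1, fun x hx => (hsub hx).2.2.1⟩,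
    fun i hi x hx => (hsub hx).2.2.2 i (Finset.mem_range.2 hi)⟩
  refine ⟨max R1 R2, min δ1 δ2, by positivity, fun g hg hn => ?_⟩
  have hc1 := h1 g (hn.mono (le_max_left _ _) (min_le_left _ _))
  obtain ⟨⟨gU, gV⟩, gW⟩ := h2 g hg (hn.mono (le_max_right _ _) (min_le_right _ _))
  have hgd : Differentiable ℂ (g^[k]) := hg.1.1.iterate k
  have hfd : Differentiable ℂ (f^[k]) := hf.1.1.iterate k
  have hDg : ∀ x ∈ closedBall p s, ‖M - fderiv ℂ (g^[k]) x‖ ≤ 1/(2*c) := by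
    intro x hx
    have a := (hsub hx).1
    have b := cx_cauchy (f := fun x => g^[k] x - f^[k] x) (hgd.sub hfd) (c := x) (r := 1) (M := ε1) one_pos (by
      intro z hz
      apply hc1
      rw [mem_closedBall, dist_zero_right]
      rw [mem_ball, dist_eq_norm] at hz
      rw [mem_closedBall, dist_eq_norm] at hx
      have e : z = (z - x) + (x - p) + p := by abel
      have := norm_add₃_le (a := z - x) (b := x - p) (c := p)
      rw [← e] at this
      linarith)
    rw [fderiv_fun_sub (hgd x) (hfd x)] at b
    have e : M - fderiv ℂ (g^[k]) x = -((fderiv ℂ (g^[k]) x - fderiv ℂ (f^[k]) x) + (fderiv ℂ (f^[k]) x - M)) := by abel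
    rw [e, norm_neg]
    refine (norm_add_le _ _).trans ?_
    have : ε1 ≤ 1/(8*c) := min_le_left _ _
    have e2 : 2 * (1/(8*c)) / 1 + 1/(4*c) = 1/(2*c) := by field_simp; norm_num
    linarith
  set Ψ : En n → En n := fun x => x - Q (g^[k] x - x) with hΨ
  have hΨd : ∀ x, HasFDerivAt Ψ (ContinuousLinearMap.id ℂ _ - Q.comp (fderiv ℂ (g^[k]) x - ContinuousLinearMap.id ℂ _)) x := by
    intro x
    have h1 := (hgd x).hasFDerivAt.fun_sub (hasFDerivAt_id x)
    exact (hasFDerivAt_id x).fun_sub (Q.hasFDerivAt.comp x h1)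
  have hΨe : ∀ x, fderiv ℂ Ψ x = Q.comp (M - fderiv ℂ (g^[k]) x) := by
    intro x
    rw [(hΨd x).fderiv]
    ext1 y
    have := hQ1 y
    simp only [map_sub] at this
    simp
    rw [sub_eq_iff_eq_add] at this
    rw [this]; abel
  have hΨn : ∀ x ∈ closedBall p s, ‖fderiv ℂ Ψ x‖ ≤ 1/2 := by
    intro x hx
    rw [hΨe]
    calc _ ≤ ‖Q‖ * ‖M - fderiv ℂ (g^[k]) x‖ := ContinuousLinearMap.opNorm_comp_le _ _
      _ ≤ c * (1/(2*c)) := by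
        gcongr
        · linarith
        · exact hDg x hx
      _ = 1/2 := by field_simp
  obtain ⟨q, hq, hqf⟩ := fp_lemma (fun x => (hΨd x).differentiableAt) hs.le hΨn (by
    have e : Ψ p - p = - Q (g^[k] p - f^[k] p) := by simp only [hΨ, hper]; abel
    rw [e, norm_neg]
    have a := hc1 p (by rw [mem_closedBall, dist_zero_right]; linarith)
    calc _ ≤ ‖Q‖ * ‖g^[k] p - f^[k] p‖ := Q.le_opNorm _
      _ ≤ c * (s/(2*c)) := by
        gcongr
        · linarith
        · exact a.trans (min_le_right _ _)
      _ = s/2 := by field_simp)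
  refine ⟨q, k, hk, ?_, ?_, ?_, ⟨iU, hiU, gU hq⟩, ⟨iV, hiV, gV hq⟩⟩
  · simp only [hΨ, sub_eq_self] at hqf
    exact sub_eq_zero.1 (hQ2 _ hqf)
  · intro i hi j hj hij
    by_contra hne
    have hne' : f^[i] p ≠ f^[j] p := fun h => hne (hinj hi hj h)
    have := hdis (mem_image_of_mem _ hi) (mem_image_of_mem _ hj) hne'
    have h3 := gW j hj hq
    simp only at hij
    rw [← hij] at h3
    exact Set.disjoint_left.1 this (gW i hi hq) h3
  · intro hev'
    obtain ⟨w, hw⟩ := hev'.exists_hasEigenvector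
    have hw0 : w ≠ 0 := hw.2
    have hMw : fderiv ℂ (g^[k]) q w = w := by simpa using hw.apply_eq_smul
    have h3 : fderiv ℂ Ψ q w = w := by
      rw [(hΨd q).fderiv]
      simp [hMw]
    have h4 := (fderiv ℂ Ψ q).le_of_opNorm_le (hΨn q hq) w
    rw [h3] at h4
    have : 0 < ‖w‖ := norm_pos_iff.2 hw0
    linarith

/-- For n ≥ 2 and nonempty open U, V ⊆ ℂⁿ, the set of f ∈ Aut_{ω₀}(ℂⁿ) having a
transverse cycle through both U and V is open and dense in Aut_{ω₀}(ℂⁿ). -/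
theorem stmt_12 (n : ℕ) (hn : 2 ≤ n) (U V : Set (En n))
    (hUo : IsOpen U) (hUne : U.Nonempty) (hVo : IsOpen V) (hVne : V.Nonempty) :
    IsOpen {f : ↥(AutOmega n) | HasTransverseCycleThrough ⇑f.1 U V} ∧
    Dense {f : ↥(AutOmega n) | HasTransverseCycleThrough ⇑f.1 U V} := by
  exact ⟨isOpen_of_openP (open_trans hUo hVo), dense_of_denseP (dense_trans hn hUo hUne hVo hVne)⟩
end
end

section
/- Let n ≥ 2. The set of automorphisms f ∈ Aut_{ω₀}(ℂⁿ) having at least one hyperbolic fixed point is dense in Aut_{ω₀}(ℂⁿ). -/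
open Topology Filter Metric Set Function

noncomputable section

lemma gen_aux {n : ℕ} (i0 : Fin n) (P : Matrix (Fin n) (Fin n) ℂ → Prop) (h1 : P 1)
    (hT : ∀ i j : Fin n, i ≠ j → ∀ c : ℂ, P (Matrix.transvection i j c))
    (hmul : ∀ A B, P A → P B → P (A * B)) (i : Fin n) (hi : i ≠ i0) (c : ℂ) (hc : c ≠ 0) :
    P (Matrix.diagonal (fun k => if k = i then c else if k = i0 then c⁻¹ else 1)) := by
  have key : ∀ M : Matrix (Fin n) (Fin n) ℂ, Matrix.transvection i i0 (-c) * (Matrix.transvection i0 i (c⁻¹) *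
     (Matrix.transvection i i0 (-c) * (Matrix.transvection i i0 1 *
      (Matrix.transvection i0 i (-1) * (Matrix.transvection i i0 1 * M))))) =
     Matrix.diagonal (fun k => if k = i then c else if k = i0 then c⁻¹ else 1) * M := by
    intro M
    have hi' := hi.symm
    ext a b
    by_cases ha : a = i
    · subst ha
      simp [hi, hi']
      field_simp
      ring
    · by_cases ha0 : a = i0
      · subst ha0
        simp [hi, hi']
        field_simp
        ring
      · simp [ha, ha0]
  rw [← mul_one (Matrix.diagonal _), ← key]
  refine hmul _ _ (hT _ _ hi _) (hmul _ _ (hT _ _ hi.symm _) (hmul _ _ (hT _ _ hi _)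
    (hmul _ _ (hT _ _ hi _) (hmul _ _ (hT _ _ hi.symm _) (hmul _ _ (hT _ _ hi _) h1)))))

lemma gen_diag {n : ℕ} (i0 : Fin n) (P : Matrix (Fin n) (Fin n) ℂ → Prop) (h1 : P 1)
    (hT : ∀ i j : Fin n, i ≠ j → ∀ c : ℂ, P (Matrix.transvection i j c))
    (hmul : ∀ A B, P A → P B → P (A * B)) (s : Finset (Fin n)) :
    i0 ∉ s → ∀ D : Fin n → ℂ, (∀ i, i ≠ i0 → i ∉ s → D i = 1) → ∏ i, D i = 1 →
      P (Matrix.diagonal D) := by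
  induction s using Finset.induction_on with
  | empty =>
    intro _ D hD hp
    have : D i0 = 1 := by
      rw [← hp]; symm
      apply Finset.prod_eq_single i0 <;> simp +contextual [hD]
    have : D = fun _ => 1 := by
      ext i; by_cases h : i = i0
      · rw [h, this]
      · exact hD i h (by simp)
    rw [this, Matrix.diagonal_one]; exact h1
  | insert i s his ih =>
    intro h0 D hD hp
    have hi : i ≠ i0 := by rintro rfl; simp at h0
    have h0s : i0 ∉ s := fun h => h0 (by simp [h])
    have hDi : D i ≠ 0 := by
      intro h
      rw [Finset.prod_eq_zero (Finset.mem_univ i) h] at hp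
      exact zero_ne_one hp
    let C : Fin n → ℂ := fun k => if k = i then D i else if k = i0 then (D i)⁻¹ else 1
    let D' : Fin n → ℂ := fun k => if k = i then 1 else if k = i0 then D i0 * D i else D k
    have hCD : ∀ k, C k * D' k = D k := by
      intro k
      simp only [C, D']
      split_ifs with h h'
      · simp [h]
      · subst h'; field_simp
      · simp
    have hC : ∏ k, C k = 1 := by
      have : ∏ k, C k = ∏ k ∈ {i, i0}, C k := by
        symm
        apply Finset.prod_subset (by simp)
        intro k _ hk
        simp at hk
        simp [C, hk]
      rw [this, Finset.prod_pair hi]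
      simp [C, hi.symm, hDi]
    have hD' : ∏ k, D' k = 1 := by
      have : ∏ k, C k * D' k = 1 := by simp_rw [hCD]; exact hp
      rwa [Finset.prod_mul_distrib, hC, one_mul] at this
    have : Matrix.diagonal D = Matrix.diagonal C * Matrix.diagonal D' := by
      rw [Matrix.diagonal_mul_diagonal]; congr 1; ext k; exact (hCD k).symm
    rw [this]
    refine hmul _ _ (gen_aux i0 P h1 hT hmul i hi _ hDi) (ih h0s D' ?_ hD')
    intro k hk hks
    simp only [D']
    split_ifs with h
    · rfl
    · exact hD k hk (by simp [h, hks])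

lemma gen_mat {n : ℕ} (i0 : Fin n) (P : Matrix (Fin n) (Fin n) ℂ → Prop) (h1 : P 1)
    (hT : ∀ i j : Fin n, i ≠ j → ∀ c : ℂ, P (Matrix.transvection i j c))
    (hmul : ∀ A B, P A → P B → P (A * B)) (M : Matrix (Fin n) (Fin n) ℂ) (hM : M.det = 1) :
    P M := by
  apply Matrix.diagonal_transvection_induction P M _ _ hmul
  · intro D hD
    apply gen_diag i0 P h1 hT hmul (Finset.univ.erase i0) (by simp) D
    · intro i hi hi'; simp at hi'; exact absurd hi' hi
    · rwa [hM, Matrix.det_diagonal] at hD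
  · intro t; exact hT _ _ t.hij _

lemma gen_lin {n : ℕ} (i0 : Fin n) (P : (En n →ₗ[ℂ] En n) → Prop) 
    (hT : ∀ (l : En n →ₗ[ℂ] ℂ) (v : En n), l v = 0 → P (LinearMap.id + l.smulRight v))
    (hmul : ∀ A B, P A → P B → P (A ∘ₗ B)) (M : En n →ₗ[ℂ] En n) (hM : LinearMap.det M = 1) :
    P M := by
  let b := (EuclideanSpace.basisFun (Fin n) ℂ).toBasis
  have h1 : P LinearMap.id := by
    have := hT 0 0 (by simp)
    simpa using this
  have := gen_mat i0 (fun A => P (Matrix.toLin b b A)) (by simpa using h1) ?_ ?_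
    (LinearMap.toMatrix b b M) (by rw [LinearMap.det_toMatrix, hM])
  · simpa using this
  · intro i j hij c
    have := hT (c • b.coord j) (b i) (by simp [Finsupp.single_apply, hij])
    convert this using 1
    apply b.ext
    intro k
    rw [Matrix.toLin_self]
    simp [Matrix.transvection, Matrix.add_apply, add_smul, Finset.sum_add_distrib, Matrix.single_apply, Matrix.one_apply, Finsupp.single_apply, ite_and, eq_comm]
  · intro A B hA hB
    rw [Matrix.toLin_mul b b b]
    exact hmul _ _ hA hB

lemma exists_hyp {n : ℕ} (i0 : Fin n) (hn : 2 ≤ n) : ∃ A : En n →ₗ[ℂ] En n, LinearMap.det A = 1 ∧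
    ∀ μ : ℂ, Module.End.HasEigenvalue (A : Module.End ℂ (En n)) μ → ‖μ‖ ≠ 1 := by
  let b := (EuclideanSpace.basisFun (Fin n) ℂ).toBasis
  let d : Fin n → ℂ := fun k => if k = i0 then (2 ^ (n-1))⁻¹ else 2
  refine ⟨Matrix.toLin b b (Matrix.diagonal d), ?_, ?_⟩
  · rw [LinearMap.det_toLin, Matrix.det_diagonal, ← Finset.mul_prod_erase _ _ (Finset.mem_univ i0)]
    rw [Finset.prod_congr rfl (g := fun _ => (2:ℂ)) (by intro x hx; simp at hx; simp [d, hx])]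
    simp [d]
  · intro μ hμ
    rw [hasEigenvalue_toLin_diagonal_iff] at hμ
    obtain ⟨i, rfl⟩ := hμ
    simp only [d]
    split_ifs
    · have : (1:ℝ) < 2 ^ (n-1) := one_lt_pow₀ (by norm_num) (by omega)
      simp
      linarith
    · simp

lemma shear_deriv {n : ℕ} (l : En n →L[ℂ] ℂ) (v : En n) (h : ℂ → ℂ)
    (hh : Differentiable ℂ h) (z : En n) :
    HasFDerivAt (fun z => z + h (l z) • v)
      (LinearMap.toContinuousLinearMap
        (LinearMap.id + (deriv h (l z) • (l : En n →ₗ[ℂ] ℂ)).smulRight v)) z := by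
  have h1 : HasFDerivAt (fun z => h (l z)) (deriv h (l z) • l) z :=
    (hh (l z)).hasDerivAt.comp_hasFDerivAt z l.hasFDerivAt
  have h2 := (hasFDerivAt_id z).add (h1.smul_const v)
  exact h2

lemma shear_mem {n : ℕ} (l : En n →L[ℂ] ℂ) (v : En n) (hv : l v = 0) (h : ℂ → ℂ)
    (hh : Differentiable ℂ h) :
    ∃ ψ ∈ AutOmega n, ∀ z, ψ z = z + h (l z) • v := by
  have hd : ∀ h : ℂ → ℂ, Differentiable ℂ h → Differentiable ℂ (fun z : En n => z + h (l z) • v) :=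
    fun h hh z => (shear_deriv l v h hh z).differentiableAt
  refine ⟨⟨fun z => z + h (l z) • v, (hd h hh).continuous⟩, ⟨⟨hd h hh, fun z => z + (- h (l z)) • v,
    hd (fun x => - h x) hh.neg, ?_, ?_⟩, ?_⟩, fun z => rfl⟩
  · intro z; simp [hv]
  · intro z; simp [hv]
  · intro z
    have := (shear_deriv l v h hh z).fderiv
    simp only [ContinuousMap.coe_mk]
    rw [this]
    have h3 := LinearMap.transvection.det (deriv h (l z) • (l : En n →ₗ[ℂ] ℂ)) v
    rw [LinearMap.smul_apply, ContinuousLinearMap.coe_coe, hv, smul_zero, add_zero] at h3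
    rw [← h3]
    unfold ContinuousLinearMap.det
    congr 1

lemma comp_mem {n : ℕ} {f g : C(En n, En n)} (hf : f ∈ AutOmega n) (hg : g ∈ AutOmega n) :
    f.comp g ∈ AutOmega n := by
  obtain ⟨⟨hf1, f', hf2, hf3, hf4⟩, hf5⟩ := hf
  obtain ⟨⟨hg1, g', hg2, hg3, hg4⟩, hg5⟩ := hg
  refine ⟨⟨hf1.comp hg1, g' ∘ f', hg2.comp hf2, hf3.comp hg3, hf4.comp hg4⟩, ?_⟩
  intro z
  rw [ContinuousMap.coe_comp, fderiv_comp z (hf1 _) (hg1 _)]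
  have h1 := hf5 (g z)
  have h2 := hg5 z
  unfold ContinuousLinearMap.det at *
  rw [ContinuousLinearMap.toLinearMap_comp, LinearMap.det_comp, h1, h2, one_mul]

/-- approximability -/
def Appr {n : ℕ} (R : ℝ) (q p : En n) (A : En n →ₗ[ℂ] En n) : Prop :=
  ∀ r < R, ∀ ε > 0, ∃ ψ ∈ AutOmega n, (∀ z, ‖z‖ ≤ r → ‖ψ z - z‖ ≤ ε) ∧ ψ q = p ∧
    HasFDerivAt ψ (LinearMap.toContinuousLinearMap A) q

lemma Appr.trans {n : ℕ} {R : ℝ} {q p s : En n} {A B : En n →ₗ[ℂ] En n}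
    (h1 : Appr R q p A) (h2 : Appr R p s B) : Appr R q s (B ∘ₗ A) := by
  intro r hr ε hε
  obtain ⟨ψ2, m2, c2, e2, d2⟩ := h2 ((r + R) / 2) (by linarith) (ε / 2) (by linarith)
  obtain ⟨ψ1, m1, c1, e1, d1⟩ := h1 r hr (min (ε / 2) ((R - r) / 2))
    (lt_min (by linarith) (by linarith))
  refine ⟨ψ2.comp ψ1, comp_mem m2 m1, ?_, by simp [e1, e2], ?_⟩
  · intro z hz
    have a1 := c1 z hz
    have a2 := a1.trans (min_le_left _ _)
    have a3 := a1.trans (min_le_right _ _)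
    have a4 : ‖ψ1 z‖ ≤ (r + R) / 2 := by
      have := norm_add_le (ψ1 z - z) z
      rw [sub_add_cancel] at this
      linarith
    have a5 := c2 _ a4
    have := norm_add_le (ψ2 (ψ1 z) - ψ1 z) (ψ1 z - z)
    rw [sub_add_sub_cancel] at this
    simp only [ContinuousMap.comp_apply]
    linarith
  · have d2' : HasFDerivAt ψ2 (LinearMap.toContinuousLinearMap B) (ψ1 q) := by rw [e1]; exact d2
    exact d2'.comp q d1

lemma appr_shear {n : ℕ} {R : ℝ} (hR : 0 ≤ R) (q : En n) (l : En n →L[ℂ] ℂ) (v : En n) (hv : l v = 0)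
    (hq : R * ‖l‖ < ‖l q‖) (a b : ℂ) :
    Appr R q (q + a • v) (LinearMap.id + (b • (l : En n →ₗ[ℂ] ℂ)).smulRight v) := by
  intro r hr ε hε
  set c := l q with hc
  have hc0 : 0 < ‖c‖ := lt_of_le_of_lt (by positivity) hq
  have hcne : c ≠ 0 := norm_pos_iff.1 hc0
  have key : ∀ N : ℕ, ∃ h : ℂ → ℂ, Differentiable ℂ h ∧ h c = a ∧ deriv h c = b ∧
      ∀ ζ : ℂ, ‖ζ‖ ≤ R * ‖l‖ →
        ‖h ζ‖ ≤ (‖ζ‖ / ‖c‖) ^ N * (‖a‖ + (‖b‖ + ‖a‖ * N / ‖c‖) * (2 * ‖c‖)) := by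
    intro N
    refine ⟨fun ζ => (ζ / c) ^ N * (a + (b - a * N / c) * (ζ - c)), by fun_prop, ?_, ?_, ?_⟩
    · simp [hcne]
    · have h1 : HasDerivAt (fun ζ : ℂ => (ζ / c) ^ N) (N * (c / c) ^ (N - 1) * (1 / c)) c :=
        ((hasDerivAt_id c).div_const c).pow N
      have h2 : HasDerivAt (fun ζ : ℂ => a + (b - a * N / c) * (ζ - c)) ((b - a * N / c) * 1) c :=
        (((hasDerivAt_id c).sub_const c).const_mul _).const_add a
      have := (h1.mul h2).deriv
      refine Eq.trans this ?_
      simp [hcne]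
      field_simp
      ring
    · intro ζ hζ
      rw [norm_mul, norm_pow, norm_div]
      gcongr
      refine (norm_add_le _ _).trans ?_
      rw [norm_mul]
      gcongr
      · refine (norm_sub_le _ _).trans ?_
        simp
      · refine (norm_sub_le _ _).trans ?_
        linarith
  -- choose N
  set ρ := max r 0 * ‖l‖ / ‖c‖ with hρ
  have hρ0 : 0 ≤ ρ := by positivity
  have hmax : max r 0 ≤ R := max_le hr.le hR
  have hρ1 : ρ < 1 := by
    rw [hρ, div_lt_one hc0]
    exact lt_of_le_of_lt (by gcongr) hq
  have lim : Tendsto (fun N : ℕ => (ρ ^ N * (‖a‖ + (‖b‖ + ‖a‖ * N / ‖c‖) * (2 * ‖c‖))) * ‖v‖)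
      atTop (𝓝 0) := by
    have t1 := tendsto_pow_atTop_nhds_zero_of_lt_one hρ0 hρ1
    have t2 := tendsto_self_mul_const_pow_of_lt_one hρ0 hρ1
    have := ((t1.mul_const (‖a‖ + ‖b‖ * (2 * ‖c‖))).add (t2.mul_const (2 * ‖a‖))).mul_const ‖v‖
    simp only [zero_mul, add_zero] at this
    refine this.congr fun N => ?_
    field_simp
    ring
  obtain ⟨N, hN⟩ := (lim.eventually (ge_mem_nhds hε)).exists
  obtain ⟨h, hd, h1, h2, h3⟩ := key N
  obtain ⟨ψ, hψ, hψe⟩ := shear_mem l v hv h hd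
  refine ⟨ψ, hψ, ?_, by rw [hψe, ← hc, h1], ?_⟩
  · intro z hz
    rw [hψe, add_sub_cancel_left, norm_smul]
    refine le_trans ?_ hN
    have hlz : ‖l z‖ ≤ max r 0 * ‖l‖ := by
      rw [mul_comm]
      exact l.le_opNorm_of_le (hz.trans (le_max_left _ _))
    have hlz' : ‖l z‖ ≤ R * ‖l‖ := hlz.trans (by gcongr)
    have := h3 _ hlz'
    have h4 : ‖l z‖ / ‖c‖ ≤ ρ := by rw [hρ]; gcongr
    refine mul_le_mul_of_nonneg_right (this.trans ?_) (norm_nonneg _)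
    gcongr
  · have := shear_deriv l v h hd q
    rw [← hc, h2] at this
    rwa [show (ψ : En n → En n) = fun z => z + h (l z) • v from funext hψe]

lemma appr_move {n : ℕ} {R : ℝ} (hR : 0 ≤ R) (q p : En n) (l : En n →L[ℂ] ℂ) (h : l q = l p)
    (hq : R * ‖l‖ < ‖l q‖) : Appr R q p LinearMap.id := by
  have := appr_shear hR q l (p - q) (by simp [h]) hq 1 0
  simpa using this

lemma appr_indep {n : ℕ} {R : ℝ} (hR : 0 ≤ R) (q p : En n) (hq : R < ‖q‖) (hp : R < ‖p‖)
    (hl : LinearIndependent ℂ ![q, p]) : Appr R q p LinearMap.id := by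
  have big : ∀ x : En n, R < ‖x‖ → R * ‖innerSL ℂ x‖ < ‖innerSL ℂ x x‖ := by
    intro x hx
    rw [innerSL_apply_norm, innerSL_apply_apply, inner_self_eq_norm_sq_to_K]
    simp
    nlinarith
  obtain ⟨s, hs1, hs2⟩ : ∃ s : En n, innerSL ℂ q s = innerSL ℂ q q ∧
      innerSL ℂ p s = innerSL ℂ p p := by
    have hq0 : q ≠ 0 := hl.ne_zero 0
    have hqq : inner ℂ q q ≠ 0 := inner_self_ne_zero.2 hq0
    let w := p - (inner ℂ q p / inner ℂ q q) • q
    have hw : w ≠ 0 := by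
      intro h
      rw [LinearIndependent.pair_iff' hq0] at hl
      exact hl _ (sub_eq_zero.1 h).symm
    have hqw : inner ℂ q w = 0 := by
      simp only [w, inner_sub_right, inner_smul_right]
      field_simp
      simp
    have hpw : inner ℂ p w ≠ 0 := by
      intro h
      apply hw
      rw [← inner_self_eq_zero (𝕜 := ℂ)]
      conv_lhs => enter [2]; simp only [w]
      rw [inner_sub_left, inner_smul_left, h, hqw]
      simp
    refine ⟨q + ((inner ℂ p p - inner ℂ p q) / inner ℂ p w) • w, ?_, ?_⟩
    · simp only [innerSL_apply_apply, inner_add_right, inner_smul_right, hqw]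
      simp
    · simp only [innerSL_apply_apply, inner_add_right, inner_smul_right]
      field_simp
      ring
  have a1 := appr_move hR q s (innerSL ℂ q) hs1.symm (big q hq)
  have a2 := appr_move hR s p (innerSL ℂ p) hs2 (by rw [hs2]; exact big p hp)
  simpa using a1.trans a2

lemma appr_any {n : ℕ} (hn : 2 ≤ n) {R : ℝ} (hR : 0 ≤ R) (q p : En n) (hq : R < ‖q‖) (hp : R < ‖p‖) :
    Appr R q p LinearMap.id := by
  by_cases hl : LinearIndependent ℂ ![q, p]
  · exact appr_indep hR q p hq hp hl
  have hq0 : q ≠ 0 := norm_pos_iff.1 (lt_of_le_of_lt hR hq)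
  have hp0 : p ≠ 0 := norm_pos_iff.1 (lt_of_le_of_lt hR hp)
  obtain ⟨w, hw⟩ : ∃ w : En n, LinearIndependent ℂ ![q, w] := by
    apply exists_linearIndependent_pair_of_one_lt_finrank _ hq0
    simp; omega
  have hw0 : w ≠ 0 := hw.ne_zero 1
  have hnw : 0 < ‖w‖ := norm_pos_iff.2 hw0
  let t : ℝ := (R + 1) / ‖w‖
  have ht : t ≠ 0 := by positivity
  have htC : (t : ℂ) ≠ 0 := by exact_mod_cast ht
  have hnorm : R < ‖(t : ℂ) • w‖ := by
    rw [norm_smul, Complex.norm_real, Real.norm_of_nonneg (by positivity)]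
    simp only [t]
    rw [div_mul_cancel₀ _ hnw.ne']
    linarith
  have i1 : LinearIndependent ℂ ![q, (t : ℂ) • w] := by
    rw [LinearIndependent.pair_iff] at hw ⊢
    intro x y hxy
    rw [smul_smul] at hxy
    have := hw _ _ hxy
    simpa [htC] using this
  have i2 : LinearIndependent ℂ ![(t : ℂ) • w, p] := by
    rw [LinearIndependent.pair_iff' hq0] at hl
    push Not at hl
    obtain ⟨a, rfl⟩ := hl
    have ha : a ≠ 0 := by rintro rfl; simp at hp0
    rw [LinearIndependent.pair_iff] at i1 ⊢
    intro x y hxy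
    rw [smul_smul y, add_comm] at hxy
    have := i1 _ _ hxy
    simp [ha] at this
    exact ⟨this.2, this.1⟩
  simpa using (appr_indep hR q _ hq hnorm i1).trans (appr_indep hR _ p hnorm hp i2)

lemma appr_transvection {n : ℕ} (hn : 2 ≤ n) {R : ℝ} (hR : 0 ≤ R) (q : En n) (hq : R < ‖q‖)
    (l : En n →ₗ[ℂ] ℂ) (v : En n) (hv : l v = 0) :
    Appr R q q (LinearMap.id + l.smulRight v) := by
  by_cases hl : l = 0
  · subst hl
    simpa using appr_any hn hR q q hq hq
  obtain ⟨w, hw⟩ : ∃ w, l w ≠ 0 := by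
    by_contra! h
    exact hl (LinearMap.ext h)
  let L := LinearMap.toContinuousLinearMap l
  have hLw : 0 < ‖L w‖ := norm_pos_iff.2 hw
  have hL : 0 < ‖L‖ := by
    rw [norm_pos_iff]; intro h; rw [h] at hLw; simp at hLw
  let t : ℝ := (R * ‖L‖ + 1) / ‖L w‖
  have hb : R * ‖L‖ < ‖L ((t : ℂ) • w)‖ := by
    rw [map_smul, norm_smul, Complex.norm_real, Real.norm_of_nonneg (by positivity)]
    simp only [t]
    rw [div_mul_cancel₀ _ hLw.ne']
    linarith
  have hn1 : R < ‖(t : ℂ) • w‖ := by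
    have := hb.trans_le (L.le_opNorm _)
    rw [mul_comm] at this
    exact lt_of_mul_lt_mul_left this hL.le
  have h1 := appr_any hn hR q _ hq hn1
  have h2 := appr_any hn hR _ q hn1 hq
  have h3 := appr_shear hR ((t : ℂ) • w) L v hv hb 0 1
  have := (h1.trans h3).trans (by simpa using h2)
  simpa [L] using this

lemma appr_SL {n : ℕ} (hn : 2 ≤ n) {R : ℝ} (hR : 0 ≤ R) (q : En n) (hq : R < ‖q‖)
    (A : En n →ₗ[ℂ] En n) (hA : LinearMap.det A = 1) : Appr R q q A :=
  gen_lin ⟨0, by omega⟩ (Appr R q q) (fun l v hv => appr_transvection hn hR q hq l v hv)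
    (fun _ _ hA hB => hB.trans hA) A hA

lemma approx {n : ℕ} (hn : 2 ≤ n) (f : C(En n, En n)) (hf : f ∈ AutOmega n) (k : ℕ) :
    ∃ g ∈ AutOmega n, (∃ p, HypFixedPt g p) ∧
      ∀ z, ‖z‖ ≤ k → ‖g z - f z‖ ≤ 1 / ((k : ℝ) + 1) := by
  obtain ⟨A, hA, hAe⟩ := exists_hyp (⟨0, by omega⟩ : Fin n) hn
  obtain ⟨r, hr⟩ := ((isCompact_closedBall (0 : En n) k).image f.continuous).isBounded.exists_norm_le
  let R := max r 0 + 1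
  have hR : 0 ≤ R := by positivity
  have hf' := hf
  obtain ⟨⟨hf1, f', hf2, hf3, hf4⟩, hf5⟩ := hf'
  obtain ⟨r2, hr2⟩ := ((isCompact_closedBall (0 : En n) R).image hf2.continuous).isBounded.exists_norm_le
  have : Nontrivial (En n) := by
    have : Nonempty (Fin n) := ⟨⟨0, by omega⟩⟩
    infer_instance
  obtain ⟨p, hp⟩ := NormedSpace.exists_lt_norm ℂ (En n) (max r2 R)
  have hp1 : R < ‖p‖ := (le_max_right _ _).trans_lt hp
  have hfp : R < ‖f p‖ := by
    by_contra! h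
    have := hr2 (f' (f p)) ⟨f p, by simpa using h, rfl⟩
    rw [hf3 p] at this
    exact absurd hp (not_lt.2 (this.trans (le_max_left _ _)))
  let M := (fderiv ℂ f p : En n →ₗ[ℂ] En n)
  have hM : LinearMap.det M = 1 := hf5 p
  let e := LinearEquiv.ofIsUnitDet (f := M) (v := (EuclideanSpace.basisFun (Fin n) ℂ).toBasis)
    (v' := (EuclideanSpace.basisFun (Fin n) ℂ).toBasis) (by rw [LinearMap.det_toMatrix, hM]; simp)
  have heM : (e.symm : En n →ₗ[ℂ] En n) ∘ₗ M = LinearMap.id := by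
    ext1 x
    exact e.symm_apply_apply x
  have hdet : LinearMap.det (A ∘ₗ (e.symm : En n →ₗ[ℂ] En n)) = 1 := by
    have := congrArg LinearMap.det heM
    rw [LinearMap.det_comp, hM, LinearMap.det_id, mul_one] at this
    rw [LinearMap.det_comp, hA, this, one_mul]
  have hap := (appr_any hn hR _ _ hfp hp1).trans (appr_SL hn hR p hp1 _ hdet)
  obtain ⟨ψ, m, c, e1, d⟩ := hap (max r 0) (by simp [R]) (1 / ((k : ℝ) + 1)) (by positivity)
  refine ⟨ψ.comp f, comp_mem m hf, ⟨p, by simpa using e1, ?_⟩, ?_⟩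
  · have h1 := (d.comp p (hf1 p).hasFDerivAt).fderiv
    have h2 : (fderiv ℂ (ψ.comp f) p : En n →ₗ[ℂ] En n) = A := by
      rw [ContinuousMap.coe_comp, h1]
      ext1 x
      have := congrArg A (LinearMap.congr_fun heM x)
      simpa [M] using this
    rw [h2]
    exact hAe
  · intro z hz
    apply c
    exact (hr _ ⟨z, by simpa using hz, rfl⟩).trans (le_max_left _ _)

/-- For n ≥ 2, automorphisms with at least one hyperbolic fixed point are dense
in Aut_{ω₀}(ℂⁿ). -/
theorem stmt_13 (n : ℕ) (hn : 2 ≤ n) :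
    Dense {f : ↥(AutOmega n) | ∃ p : En n, HypFixedPt ⇑f.1 p} := by
  rintro ⟨f, hf⟩
  choose g hg1 hg2 hg3 using approx hn f hf
  refine mem_closure_of_tendsto (f := fun k => (⟨g k, hg1 k⟩ : AutOmega n)) (b := atTop) ?_
    (Eventually.of_forall hg2)
  rw [tendsto_subtype_rng, ContinuousMap.tendsto_iff_forall_isCompact_tendstoUniformlyOn]
  intro K hK
  obtain ⟨r, hr⟩ := hK.isBounded.exists_norm_le
  rw [Metric.tendstoUniformlyOn_iff]
  intro ε hε
  have t := (tendsto_one_div_add_atTop_nhds_zero_nat (𝕜 := ℝ)).eventually (gt_mem_nhds hε)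
  filter_upwards [t, eventually_ge_atTop ⌈r⌉₊] with k hk hkr z hz
  rw [dist_comm, dist_eq_norm]
  exact (hg3 k z ((hr z hz).trans (Nat.ceil_le.1 hkr))).trans_lt hk
end
end
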